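/- arXiv:math/0404013 — 6 statements merged into one kernel-verified Lean document; each statement's English description precedes it below -/
import Mathlib

section
/- Let H be a complex inner product space with dim_ℂ H ≥ 3 and let f : ℂ → ℂ. Then for every n ∈ ℕ and every choice of vectors z¹,...,zⁿ ∈ H the n×n matrix (f(⟨z^r, z^s⟩))_{r,s=1}^n is Hermitian positive semidefinite if and only if f is of form (3.1), i.e., there exist nonnegative reals b_{k,ℓ} (k,ℓ ∈ ℕ) such that for every z ∈ ℂ the family (b_{k,ℓ} z^k conj(z)^ℓ)_{(k,ℓ)∈ℕ×ℕ} is summable with sum f(z). -/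
open ComplexConjugate
open scoped ComplexOrder InnerProductSpace

/-- A function `f : ℂ → ℂ` is of form (3.1): there exist nonnegative reals `b (k,ℓ)`
such that for every `z ∈ ℂ` the family `b (k,ℓ) * z^k * conj z ^ ℓ` is summable with sum `f z`. -/
def Form31 (f : ℂ → ℂ) : Prop :=
  ∃ b : ℕ × ℕ → ℝ, (∀ kl, 0 ≤ b kl) ∧
    ∀ z : ℂ, HasSum (fun kl : ℕ × ℕ => (b kl : ℂ) * z ^ kl.1 * (conj z) ^ kl.2) (f z)

section

open Filter Topology Asymptotics

lemma exists_dual_nodes {K : Type*} [Field K] {m : ℕ} (v : Fin m → K)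
    (hv : Function.Injective v) (k : Fin m) :
    ∃ c : Fin m → K, ∀ l : Fin m, ∑ i, c i * v i ^ (l : ℕ) = if l = k then 1 else 0 := by
  have hdet : IsUnit (Matrix.vandermonde v).det :=
    (Matrix.det_vandermonde_ne_zero_iff.mpr hv).isUnit
  refine ⟨Matrix.vecMul (Pi.single k 1) (Matrix.vandermonde v)⁻¹, fun l => ?_⟩
  have h : Matrix.vecMul (Matrix.vecMul (Pi.single k 1) (Matrix.vandermonde v)⁻¹)
      (Matrix.vandermonde v) = Pi.single k 1 := by
    rw [Matrix.vecMul_vecMul, Matrix.nonsing_inv_mul _ hdet, Matrix.vecMul_one]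
  have := congrFun h l
  simpa [Matrix.vecMul, dotProduct, Matrix.vandermonde_apply, Pi.single_apply] using this

/-- If the Hankel-type quadratic forms `∑ cᵢ cⱼ u(ε xᵢ xⱼ)` are nonnegative, then so is every
one-sided Taylor coefficient of `u` at `0`. -/
lemma coeff_nonneg_of_isLittleO {u : ℝ → ℝ} {n : ℕ} {p : ℕ → ℝ}
    (hu : (fun t => u t - ∑ k ∈ Finset.range (n + 1), p k * t ^ k) =o[𝓝[>] 0] fun t => t ^ n)
    (hpos : ∀ (m : ℕ) (x c : Fin m → ℝ), (∀ i, 0 < x i) → ∀ᶠ ε in 𝓝[>] (0 : ℝ),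
      0 ≤ ∑ i, ∑ j, c i * c j * u (ε * (x i * x j))) :
    0 ≤ p n := by
  obtain ⟨c, hc⟩ := exists_dual_nodes (fun i : Fin (n + 1) => ((i : ℕ) : ℝ) + 1)
    (fun i j h => by simpa [Fin.ext_iff] using h) (Fin.last n)
  set x : Fin (n + 1) → ℝ := fun i => ((i : ℕ) : ℝ) + 1 with hx
  replace hc : ∀ l : Fin (n + 1), ∑ i, c i * x i ^ (l : ℕ) = if l = Fin.last n then 1 else 0 := hc
  have hx0 : ∀ i, 0 < x i := fun i => by positivity
  set r : ℝ → ℝ := fun t => u t - ∑ k ∈ Finset.range (n + 1), p k * t ^ k with hr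
  have hsum : ∀ ε : ℝ, ∑ i, ∑ j, c i * c j * u (ε * (x i * x j)) =
      p n * ε ^ n + ∑ i, ∑ j, c i * c j * r (ε * (x i * x j)) := by
    intro ε
    have h1 : ∀ t, u t = ∑ k : Fin (n + 1), p k * t ^ (k : ℕ) + r t := by
      intro t
      rw [Fin.sum_univ_eq_sum_range (fun k => p k * t ^ k) (n + 1)]
      simp only [hr]
      ring
    simp_rw [h1, mul_add, Finset.sum_add_distrib]
    congr 1
    calc ∑ i, ∑ j, c i * c j * ∑ k : Fin (n + 1), p k * (ε * (x i * x j)) ^ (k : ℕ)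
        = ∑ k : Fin (n + 1), p k * ε ^ (k : ℕ) *
            ((∑ i, c i * x i ^ (k : ℕ)) * ∑ j, c j * x j ^ (k : ℕ)) := by
          simp_rw [Finset.sum_mul_sum, Finset.mul_sum]
          rw [Finset.sum_comm_cycle]
          refine Finset.sum_congr rfl fun k _ => Finset.sum_congr rfl fun i _ =>
            Finset.sum_congr rfl fun j _ => ?_
          rw [mul_pow, mul_pow]; ring
      _ = p n * ε ^ n := by
          simp_rw [hc]
          simp
  have hlim : Tendsto (fun ε : ℝ => (∑ i, ∑ j, c i * c j * u (ε * (x i * x j))) / ε ^ n)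
      (𝓝[>] 0) (𝓝 (p n)) := by
    have h2 : (fun ε : ℝ => ∑ i, ∑ j, c i * c j * r (ε * (x i * x j)))
        =o[𝓝[>] 0] fun ε => ε ^ n := by
      refine IsLittleO.fun_sum fun i _ => IsLittleO.fun_sum fun j _ => IsLittleO.const_mul_left ?_ _
      have hxx : 0 < x i * x j := mul_pos (hx0 i) (hx0 j)
      have ht : Tendsto (fun ε : ℝ => ε * (x i * x j)) (𝓝[>] 0) (𝓝[>] 0) := by
        refine tendsto_nhdsWithin_iff.2 ⟨?_, ?_⟩
        · have : Tendsto (fun ε : ℝ => ε * (x i * x j)) (𝓝 0) (𝓝 (0 * (x i * x j))) :=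
            (continuous_id.mul continuous_const).tendsto 0
          rw [zero_mul] at this
          exact this.mono_left nhdsWithin_le_nhds
        · filter_upwards [self_mem_nhdsWithin] with ε hε using mul_pos hε hxx
      refine (hu.comp_tendsto ht).trans_isBigO ?_
      refine IsBigO.of_bound ((x i * x j) ^ n) (Eventually.of_forall fun ε => ?_)
      simp [mul_pow, mul_comm, abs_of_pos (hx0 i), abs_of_pos (hx0 j)]
    have h3 := h2.tendsto_div_nhds_zero.const_add (p n)
    rw [add_zero] at h3
    refine h3.congr' ?_
    filter_upwards [self_mem_nhdsWithin] with ε hε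
    have : ε ^ n ≠ 0 := pow_ne_zero _ (ne_of_gt hε)
    rw [hsum]
    field_simp
  refine ge_of_tendsto hlim ?_
  filter_upwards [hpos _ x c hx0, self_mem_nhdsWithin] with ε h hε
  exact div_nonneg h (pow_nonneg (le_of_lt hε) _)

lemma fwdDiff_iter_nonneg_of_iteratedDeriv_nonneg {w : ℝ → ℝ} (hw : ContDiff ℝ (⊤ : ℕ∞) w) {a : ℝ}
    {n : ℕ} (hpos : ∀ x, a ≤ x → 0 ≤ iteratedDeriv n w x) {h x : ℝ} (hh : 0 ≤ h) (hx : a ≤ x) :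
    0 ≤ (fwdDiff h)^[n] w x := by
  induction n generalizing w x with
  | zero => simpa using hpos x hx
  | succ n ih =>
    rw [Function.iterate_succ_apply]
    have hshift : ContDiff ℝ (⊤ : ℕ∞) fun y => w (y + h) := hw.comp (contDiff_id.add contDiff_const)
    refine ih (w := fwdDiff h w) (hshift.sub hw) (fun y hy => ?_) hx
    have hsub : iteratedDeriv n (fwdDiff h w) y =
        iteratedDeriv n w (y + h) - iteratedDeriv n w y := by
      have h1 : fwdDiff h w = (fun y => w (y + h)) - w := rfl
      rw [h1, iteratedDeriv_sub, iteratedDeriv_comp_add_const]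
      · exact (hshift.of_le (by exact_mod_cast le_top)).contDiffAt
      · exact (hw.of_le (by exact_mod_cast le_top)).contDiffAt
    have hdiff : Differentiable ℝ (iteratedDeriv n w) :=
      hw.differentiable_iteratedDeriv n (by exact_mod_cast WithTop.coe_lt_top n)
    have hmono : MonotoneOn (iteratedDeriv n w) (Set.Ici a) := by
      refine monotoneOn_of_deriv_nonneg (convex_Ici a) hdiff.continuous.continuousOn
        hdiff.differentiableOn fun z hz => ?_
      rw [interior_Ici] at hz
      rw [← iteratedDeriv_succ]
      exact hpos z (le_of_lt hz)
    rw [hsub, sub_nonneg]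
    exact hmono hy (by simp only [Set.mem_Ici]; linarith) (by linarith)

lemma iteratedDeriv_nonneg_of_quadratic_form {w : ℝ → ℝ} (hw : ContDiff ℝ (⊤ : ℕ∞) w) {a : ℝ}
    (hpos : ∀ (m : ℕ) (x c : Fin m → ℝ), (∀ i, 0 < x i) →
      0 ≤ ∑ i, ∑ j, c i * c j * w (a + x i * x j)) (n : ℕ) :
    0 ≤ iteratedDeriv n w a := by
  have key : 0 ≤ ((n.factorial : ℝ))⁻¹ * iteratedDeriv n w a := by
    refine coeff_nonneg_of_isLittleO (u := fun t => w (a + t))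
      (p := fun k => ((k.factorial : ℝ))⁻¹ * iteratedDeriv k w a) ?_ ?_
    · have h1 := taylor_isLittleO_univ (n := n) (x₀ := a)
        (hw.of_le (by exact_mod_cast le_top : ((n : ℕ∞) : WithTop ℕ∞) ≤ (⊤ : ℕ∞)))
      have ht : Tendsto (fun t : ℝ => a + t) (𝓝[>] 0) (𝓝 a) := by
        have : Tendsto (fun t : ℝ => a + t) (𝓝 0) (𝓝 (a + 0)) :=
          (continuous_const.add continuous_id).tendsto 0
        rw [add_zero] at this
        exact this.mono_left nhdsWithin_le_nhds
      have h2 := h1.comp_tendsto ht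
      refine (h2.congr (fun t => ?_) fun t => ?_)
      · simp only [Function.comp, taylor_within_apply, iteratedDerivWithin_univ, add_sub_cancel_left,
          smul_eq_mul]
        congr 1
        exact Finset.sum_congr rfl fun k _ => by ring
      · simp
    · intro m x c hx
      filter_upwards [self_mem_nhdsWithin] with ε hε
      have h := hpos m (fun i => √ε * x i) c fun i => mul_pos (Real.sqrt_pos.2 hε) (hx i)
      refine h.trans_eq (Finset.sum_congr rfl fun i _ => Finset.sum_congr rfl fun j _ => ?_)
      have : √ε * √ε = ε := Real.mul_self_sqrt (le_of_lt hε)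
      rw [show √ε * x i * (√ε * x j) = (√ε * √ε) * (x i * x j) by ring, this]
  exact nonneg_of_mul_nonneg_right key (by positivity)

/-- A continuous function whose quadratic forms `∑ cᵢ cⱼ u(a + xᵢ xⱼ)` are all nonnegative is
absolutely monotone, in the sense of finite differences. -/
lemma fwdDiff_iter_nonneg_of_quadratic_form {u : ℝ → ℝ} (hu : Continuous u)
    (hpos : ∀ a, 0 ≤ a → ∀ (m : ℕ) (x c : Fin m → ℝ), (∀ i, 0 < x i) →
      0 ≤ ∑ i, ∑ j, c i * c j * u (a + x i * x j)) (n : ℕ) {h : ℝ} (hh : 0 ≤ h) :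
    0 ≤ (fwdDiff h)^[n] u 0 := by
  let φ : ℕ → ContDiffBump (0 : ℝ) := fun N =>
    ⟨1 / (2 * ((N : ℝ) + 1)), 1 / ((N : ℝ) + 1), by positivity, by
      apply one_div_lt_one_div_of_lt <;> [positivity; skip]
      have : (0 : ℝ) < N + 1 := by positivity
      linarith⟩
  let w : ℕ → ℝ → ℝ := fun N => MeasureTheory.convolution ((φ N).normed MeasureTheory.volume) u
    (ContinuousLinearMap.lsmul ℝ ℝ) MeasureTheory.volume
  have hsmooth : ∀ N, ContDiff ℝ (⊤ : ℕ∞) (w N) := fun N =>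
    HasCompactSupport.contDiff_convolution_left _ (φ N).hasCompactSupport_normed
      (φ N).contDiff_normed hu.locallyIntegrable
  have hwdef : ∀ N t, w N t = ∫ s, (φ N).normed MeasureTheory.volume s * u (t - s) := by
    intro N t
    simp [w, MeasureTheory.convolution_def]
  have hint : ∀ N t, MeasureTheory.Integrable
      fun s => (φ N).normed MeasureTheory.volume s * u (t - s) := by
    intro N t
    refine Continuous.integrable_of_hasCompactSupport ?_ ?_
    · exact (φ N).continuous_normed.mul (hu.comp (continuous_const.sub continuous_id))
    · exact (φ N).hasCompactSupport_normed.mul_right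
  have hrout : ∀ N : ℕ, (φ N).rOut = 1 / ((N : ℝ) + 1) := fun N => rfl
  have hwpos : ∀ (N : ℕ) (a : ℝ), 1 / ((N : ℝ) + 1) ≤ a → ∀ (m : ℕ) (x c : Fin m → ℝ), (∀ i, 0 < x i) →
      0 ≤ ∑ i, ∑ j, c i * c j * w N (a + x i * x j) := by
    intro N a ha m x c hx
    have : ∑ i, ∑ j, c i * c j * w N (a + x i * x j) =
        ∫ s, ∑ i, ∑ j, c i * c j *
          ((φ N).normed MeasureTheory.volume s * u (a + x i * x j - s)) := by
      rw [MeasureTheory.integral_finsetSum _ fun i _ =>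
        MeasureTheory.integrable_finsetSum _ fun j _ => (hint N _).const_mul _]
      refine Finset.sum_congr rfl fun i _ => ?_
      rw [MeasureTheory.integral_finsetSum _ fun j _ => (hint N _).const_mul _]
      refine Finset.sum_congr rfl fun j _ => ?_
      rw [MeasureTheory.integral_const_mul, hwdef]
    rw [this]
    refine MeasureTheory.integral_nonneg fun s => ?_
    have heq : ∑ i, ∑ j, c i * c j *
          ((φ N).normed MeasureTheory.volume s * u (a + x i * x j - s)) =
        (φ N).normed MeasureTheory.volume s *
          ∑ i, ∑ j, c i * c j * u ((a - s) + x i * x j) := by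
      simp_rw [Finset.mul_sum]
      refine Finset.sum_congr rfl fun i _ => Finset.sum_congr rfl fun j _ => ?_
      rw [show a + x i * x j - s = (a - s) + x i * x j by ring]; ring
    simp only [Pi.zero_apply]
    rw [heq]
    by_cases hs : s ∈ Function.support ((φ N).normed MeasureTheory.volume)
    · rw [(φ N).support_normed_eq, hrout, mem_ball_zero_iff, Real.norm_eq_abs] at hs
      have := (abs_lt.1 hs).2
      exact mul_nonneg ((φ N).nonneg_normed s) (hpos _ (by linarith) m x c hx)
    · rw [Function.notMem_support.1 hs, zero_mul]
  have hdiff : ∀ N : ℕ, 0 ≤ (fwdDiff h)^[n] (w N) (1 / ((N : ℝ) + 1)) := fun N =>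
    fwdDiff_iter_nonneg_of_iteratedDeriv_nonneg (hsmooth N) (a := 1 / ((N : ℝ) + 1))
      (fun x hx => iteratedDeriv_nonneg_of_quadratic_form (hsmooth N)
        (hwpos N x hx) n) hh le_rfl
  have hε : Tendsto (fun N : ℕ => 1 / ((N : ℝ) + 1)) atTop (𝓝 0) :=
    tendsto_one_div_add_atTop_nhds_zero_nat
  have hlim : Tendsto (fun N : ℕ => (fwdDiff h)^[n] (w N) (1 / ((N : ℝ) + 1))) atTop
      (𝓝 ((fwdDiff h)^[n] u 0)) := by
    simp_rw [fwdDiff_iter_eq_sum_shift]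
    refine tendsto_finsetSum _ fun k _ => Tendsto.const_smul ?_ _
    refine ContDiffBump.convolution_tendsto_right (φ := φ) (g := fun _ => u) hε
      (Eventually.of_forall fun _ => hu.aestronglyMeasurable) ?_ (hε.add_const (k • h))
    exact (hu.tendsto _).comp tendsto_snd
  exact ge_of_tendsto' hlim hdiff

/-- Bernstein's polynomial, rewritten as a Newton series of forward differences. -/
lemma sum_bernstein_eq_sum_fwdDiff {E : Type*} [AddCommGroup E] [Module ℝ E] (f : ℝ → E) (h x : ℝ)
    (n : ℕ) :
    ∑ k ∈ Finset.range (n + 1), ((n.choose k : ℝ) * x ^ k * (1 - x) ^ (n - k)) • f (k • h) =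
      ∑ k ∈ Finset.range (n + 1), ((n.choose k : ℝ) * x ^ k) • (fwdDiff h)^[k] f 0 := by
  let T : Polynomial ℝ →ₗ[ℝ] E :=
    Polynomial.lsum fun j => LinearMap.toSpanSingleton ℝ E ((fwdDiff h)^[j] f 0)
  have hT : ∀ j : ℕ, T (Polynomial.X ^ j) = (fwdDiff h)^[j] f 0 := by
    intro j
    simp [T, Polynomial.X_pow_eq_monomial, Polynomial.lsum_apply]
  have hTpow : ∀ k : ℕ, T ((Polynomial.X + 1) ^ k) = f (k • h) := by
    intro k
    have h0 := shift_eq_sum_fwdDiff_iter h f k 0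
    rw [zero_add] at h0
    rw [h0, add_pow, map_sum]
    refine Finset.sum_congr rfl fun j _ => ?_
    rw [one_pow, mul_one, mul_comm, ← nsmul_eq_mul, map_nsmul, hT]
  have hpoly : ∑ k ∈ Finset.range (n + 1),
      Polynomial.C ((n.choose k : ℝ) * x ^ k * (1 - x) ^ (n - k)) * (Polynomial.X + 1) ^ k =
      ∑ k ∈ Finset.range (n + 1), Polynomial.C ((n.choose k : ℝ) * x ^ k) * Polynomial.X ^ k := by
    calc _ = (Polynomial.C x * (Polynomial.X + 1) + Polynomial.C (1 - x)) ^ n := by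
          rw [add_pow]
          refine Finset.sum_congr rfl fun k _ => ?_
          simp only [map_mul, map_pow, mul_pow, map_natCast]
          ring
      _ = (Polynomial.C x * Polynomial.X + 1) ^ n := by
          congr 1
          simp only [map_sub, map_one]
          ring
      _ = _ := by
          rw [add_pow]
          refine Finset.sum_congr rfl fun k _ => ?_
          simp only [map_mul, map_pow, mul_pow, map_natCast, one_pow]
          ring
  have := congrArg T hpoly
  rw [map_sum, map_sum] at this
  simpa only [hT, ← Polynomial.smul_eq_C_mul, map_smul, hTpow] using this

lemma eventually_norm_sum_fwdDiff_sub_lt {E : Type*} [NormedAddCommGroup E] [NormedSpace ℝ E]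
    {f : ℝ → E} (hf : Continuous f) {R δ : ℝ} (hR : 0 < R) (hδ : 0 < δ) :
    ∀ᶠ n : ℕ in atTop, ∀ t, 0 ≤ t → t ≤ R →
      ‖∑ k ∈ Finset.range (n + 1), ((n.choose k : ℝ) * (t / R) ^ k) • (fwdDiff (R / n))^[k] f 0
        - f t‖ < δ := by
  let g : C(unitInterval, E) := ⟨fun x => f (R * x), by fun_prop⟩
  have h1 := (Metric.tendsto_nhds.1 (bernsteinApproximation_uniform g)) δ hδ
  filter_upwards [h1] with n hn t ht0 htR
  have hx : t / R ∈ unitInterval := ⟨by positivity, by rw [div_le_one hR]; exact htR⟩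
  have h2 := ContinuousMap.dist_apply_le_dist (f := bernsteinApproximation n g) (g := g) ⟨t / R, hx⟩
  have h3 := lt_of_le_of_lt h2 hn
  rw [dist_eq_norm, bernsteinApproximation.apply] at h3
  refine lt_of_eq_of_lt (congrArg norm (congrArg₂ (· - ·) ?_ ?_)) h3
  · rw [← sum_bernstein_eq_sum_fwdDiff, ← Fin.sum_univ_eq_sum_range
      (fun k => ((n.choose k : ℝ) * (t / R) ^ k * (1 - t / R) ^ (n - k)) • f (k • (R / n)))]
    refine Finset.sum_congr rfl fun k _ => ?_
    rw [bernstein_apply]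
    simp only [g, ContinuousMap.coe_mk, bernstein.z, nsmul_eq_mul]
    congr 2
    ring
  · simp only [g, ContinuousMap.coe_mk]
    congr 1
    field_simp

/-- Power series with coefficients dominated by nonnegative ones are closed under pointwise limits
on `[0, ∞)`. -/
lemma exists_hasSum_of_tendsto {p : ℕ → ℕ → ℂ} {q : ℕ → ℕ → ℝ} {u : ℝ → ℂ} {v : ℝ → ℝ}
    (hpq : ∀ M k, ‖p M k‖ ≤ q M k)
    (hq : ∀ M t, 0 ≤ t → Summable fun k => q M k * t ^ k)
    (hv : ∀ t, 0 ≤ t → Tendsto (fun M => ∑' k, q M k * t ^ k) atTop (𝓝 (v t)))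
    (hu : ∀ t : ℝ, 0 ≤ t → Tendsto (fun M => ∑' k, p M k * (t : ℂ) ^ k) atTop (𝓝 (u t))) :
    ∃ (p' : ℕ → ℂ) (q' : ℕ → ℝ), (∀ k, ‖p' k‖ ≤ q' k) ∧ ∀ t : ℝ, 0 ≤ t →
      HasSum (fun k => q' k * t ^ k) (v t) ∧ HasSum (fun k => p' k * (t : ℂ) ^ k) (u t) := by
  let U : Ultrafilter ℕ := hyperfilter ℕ
  have hU : (U : Filter ℕ) ≤ atTop := Nat.hyperfilter_le_atTop
  have hq0 : ∀ M k, 0 ≤ q M k := fun M k => (norm_nonneg _).trans (hpq M k)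
  have hbound : ∀ R : ℝ, 0 ≤ R → ∀ᶠ M in (U : Filter ℕ), ∀ k, q M k * R ^ k ≤ v R + 1 := by
    intro R hR
    filter_upwards [hU ((hv R hR).eventually_lt_const (lt_add_one _))] with M hM k
    exact ((hq M R hR).le_tsum k fun j _ => mul_nonneg (hq0 M j) (pow_nonneg hR j)).trans hM.le
  have hqlim : ∀ k, ∃ y, Tendsto (fun M => q M k) U (𝓝 y) := by
    intro k
    obtain ⟨y, -, hy⟩ := (isCompact_Icc (a := (0 : ℝ)) (b := v 1 + 1)).ultrafilter_le_nhds'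
      (U.map fun M => q M k) (Ultrafilter.mem_map.2 <| Ultrafilter.mem_coe.1 <| by
        filter_upwards [hbound 1 zero_le_one] with M hM
        exact ⟨hq0 M k, by simpa using hM k⟩)
    exact ⟨y, hy⟩
  have hplim : ∀ k, ∃ y, Tendsto (fun M => p M k) U (𝓝 y) := by
    intro k
    obtain ⟨y, -, hy⟩ := (isCompact_closedBall (0 : ℂ) (v 1 + 1)).ultrafilter_le_nhds'
      (U.map fun M => p M k) (Ultrafilter.mem_map.2 <| Ultrafilter.mem_coe.1 <| by
        filter_upwards [hbound 1 zero_le_one] with M hM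
        have : ‖p M k‖ ≤ v 1 + 1 := (hpq M k).trans (by simpa using hM k)
        simpa using this)
    exact ⟨y, hy⟩
  choose q' hq' using hqlim
  choose p' hp' using hplim
  have hpq' : ∀ k, ‖p' k‖ ≤ q' k := fun k => le_of_tendsto_of_tendsto' (hp' k).norm (hq' k)
    fun M => hpq M k
  refine ⟨p', q', hpq', fun t ht => ?_⟩
  have hR : 0 < t + 1 := by linarith
  have hgeo : Summable fun k : ℕ => (v (t + 1) + 1) * (t / (t + 1)) ^ k :=
    (summable_geometric_of_lt_one (by positivity) (by rw [div_lt_one hR]; linarith)).mul_left _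
  have hdom : ∀ᶠ M in (U : Filter ℕ), ∀ k,
      q M k * t ^ k ≤ (v (t + 1) + 1) * (t / (t + 1)) ^ k := by
    filter_upwards [hbound (t + 1) hR.le] with M hM k
    have h1 : q M k * t ^ k = (q M k * (t + 1) ^ k) * (t / (t + 1)) ^ k := by
      rw [div_pow]; field_simp
    rw [h1]
    exact mul_le_mul_of_nonneg_right (hM k) (by positivity)
  have hqt : ∀ k, Tendsto (fun M => q M k * t ^ k) U (𝓝 (q' k * t ^ k)) :=
    fun k => (hq' k).mul_const _
  have hpt : ∀ k, Tendsto (fun M => p M k * (t : ℂ) ^ k) U (𝓝 (p' k * (t : ℂ) ^ k)) :=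
    fun k => (hp' k).mul_const _
  have hle : ∀ k, q' k * t ^ k ≤ (v (t + 1) + 1) * (t / (t + 1)) ^ k := fun k =>
    le_of_tendsto (hqt k) (hdom.mono fun M hM => hM k)
  have hnorm : ∀ (P : ℂ) (k : ℕ), ‖P * (t : ℂ) ^ k‖ = ‖P‖ * t ^ k := by
    intro P k
    rw [norm_mul, norm_pow, Complex.norm_of_nonneg ht]
  have hsq : Summable fun k => q' k * t ^ k :=
    Summable.of_nonneg_of_le (fun k => mul_nonneg ((norm_nonneg _).trans (hpq' k))
      (pow_nonneg ht k)) hle hgeo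
  have hsp : Summable fun k => p' k * (t : ℂ) ^ k := by
    refine Summable.of_norm_bounded hsq fun k => ?_
    rw [hnorm]
    exact mul_le_mul_of_nonneg_right (hpq' k) (pow_nonneg ht k)
  constructor
  · have h1 := tendsto_tsum_of_dominated_convergence hgeo hqt (by
      filter_upwards [hdom] with M hM k
      rw [Real.norm_of_nonneg (mul_nonneg (hq0 M k) (pow_nonneg ht k))]
      exact hM k)
    rw [tendsto_nhds_unique ((hv t ht).mono_left hU) h1]
    exact hsq.hasSum
  · have h1 := tendsto_tsum_of_dominated_convergence hgeo hpt (by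
      filter_upwards [hdom] with M hM k
      rw [hnorm]
      exact (mul_le_mul_of_nonneg_right (hpq M k) (pow_nonneg ht k)).trans (hM k))
    rw [tendsto_nhds_unique ((hu t ht).mono_left hU) h1]
    exact hsp.hasSum

/-- **Bernstein's theorem** on absolutely monotone functions, in a dominated form: if the forward
differences of `u` at `0` are bounded by those of `v`, both functions are given on `[0, ∞)` by
everywhere convergent power series. -/
lemma exists_hasSum_of_norm_fwdDiff_le {u : ℝ → ℂ} {v : ℝ → ℝ} (hu : Continuous u)
    (hv : Continuous v)
    (huv : ∀ (n : ℕ) (h : ℝ), 0 ≤ h → ‖(fwdDiff h)^[n] u 0‖ ≤ (fwdDiff h)^[n] v 0) :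
    ∃ (p : ℕ → ℂ) (q : ℕ → ℝ), (∀ k, ‖p k‖ ≤ q k) ∧ ∀ t : ℝ, 0 ≤ t →
      HasSum (fun k => q k * t ^ k) (v t) ∧ HasSum (fun k => p k * (t : ℂ) ^ k) (u t) := by
  have hex : ∀ M : ℕ, ∃ n : ℕ, (∀ t : ℝ, 0 ≤ t → t ≤ M + 1 →
      ‖∑ k ∈ Finset.range (n + 1), ((n.choose k : ℝ) * (t / (M + 1)) ^ k) •
        (fwdDiff (((M : ℝ) + 1) / n))^[k] u 0 - u t‖ < 1 / ((M : ℝ) + 1)) ∧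
      (∀ t : ℝ, 0 ≤ t → t ≤ M + 1 →
      ‖∑ k ∈ Finset.range (n + 1), ((n.choose k : ℝ) * (t / (M + 1)) ^ k) •
        (fwdDiff (((M : ℝ) + 1) / n))^[k] v 0 - v t‖ < 1 / ((M : ℝ) + 1)) := by
    intro M
    have hM : (0 : ℝ) < M + 1 := by positivity
    exact ((eventually_norm_sum_fwdDiff_sub_lt hu hM (one_div_pos.2 hM)).and
      (eventually_norm_sum_fwdDiff_sub_lt hv hM (one_div_pos.2 hM))).exists
  choose n hnu hnv using hex
  let a : ℕ → ℕ → ℝ := fun M k => ((n M).choose k : ℝ) / ((M : ℝ) + 1) ^ k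
  have ha : ∀ M k, 0 ≤ a M k := fun M k => by positivity
  have ha0 : ∀ M k, k ∉ Finset.range (n M + 1) → a M k = 0 := by
    intro M k hk
    rw [Finset.mem_range, not_lt] at hk
    simp [a, Nat.choose_eq_zero_of_lt (Nat.lt_of_succ_le hk)]
  let p : ℕ → ℕ → ℂ := fun M k => a M k * (fwdDiff (((M : ℝ) + 1) / n M))^[k] u 0
  let q : ℕ → ℕ → ℝ := fun M k => a M k * (fwdDiff (((M : ℝ) + 1) / n M))^[k] v 0
  have hqs : ∀ (M : ℕ) (t : ℝ), HasSum (fun k => q M k * t ^ k)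
      (∑ k ∈ Finset.range (n M + 1), (((n M).choose k : ℝ) * (t / (M + 1)) ^ k) •
        (fwdDiff (((M : ℝ) + 1) / n M))^[k] v 0) := by
    intro M t
    have : ∑ k ∈ Finset.range (n M + 1), (((n M).choose k : ℝ) * (t / (M + 1)) ^ k) •
        (fwdDiff (((M : ℝ) + 1) / n M))^[k] v 0 =
        ∑ k ∈ Finset.range (n M + 1), q M k * t ^ k := by
      refine Finset.sum_congr rfl fun k _ => ?_
      simp only [q, a, smul_eq_mul, div_pow]
      ring
    rw [this]
    exact hasSum_sum_of_ne_finset_zero fun k hk => by simp [q, ha0 M k hk]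
  have hps : ∀ (M : ℕ) (t : ℝ), HasSum (fun k => p M k * (t : ℂ) ^ k)
      (∑ k ∈ Finset.range (n M + 1), (((n M).choose k : ℝ) * (t / (M + 1)) ^ k) •
        (fwdDiff (((M : ℝ) + 1) / n M))^[k] u 0) := by
    intro M t
    have : ∑ k ∈ Finset.range (n M + 1), (((n M).choose k : ℝ) * (t / (M + 1)) ^ k) •
        (fwdDiff (((M : ℝ) + 1) / n M))^[k] u 0 =
        ∑ k ∈ Finset.range (n M + 1), p M k * (t : ℂ) ^ k := by
      refine Finset.sum_congr rfl fun k _ => ?_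
      simp only [p, a, Complex.real_smul, div_pow]
      push_cast
      ring
    rw [this]
    exact hasSum_sum_of_ne_finset_zero fun k hk => by simp [p, ha0 M k hk]
  have hlarge : ∀ t : ℝ, ∀ᶠ M : ℕ in atTop, t ≤ M + 1 := fun t => by
    filter_upwards [eventually_ge_atTop ⌈t⌉₊] with M hM
    have := Nat.ceil_le.1 hM
    linarith
  refine exists_hasSum_of_tendsto (p := p) (q := q) ?_ (fun M t _ => (hqs M t).summable) ?_ ?_
  · intro M k
    simp only [p, q]
    rw [norm_mul, Complex.norm_of_nonneg (ha M k)]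
    exact mul_le_mul_of_nonneg_left (huv k _ (by positivity)) (ha M k)
  · intro t ht
    rw [tendsto_iff_norm_sub_tendsto_zero]
    refine squeeze_zero' (Eventually.of_forall fun _ => norm_nonneg _) ?_
      tendsto_one_div_add_atTop_nhds_zero_nat
    filter_upwards [hlarge t] with M hM
    rw [(hqs M t).tsum_eq]
    exact (hnv M t ht hM).le
  · intro t ht
    rw [tendsto_iff_norm_sub_tendsto_zero]
    refine squeeze_zero' (Eventually.of_forall fun _ => norm_nonneg _) ?_
      tendsto_one_div_add_atTop_nhds_zero_nat
    filter_upwards [hlarge t] with M hM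
    rw [(hps M t).tsum_eq]
    exact (hnu M t ht hM).le

/-- `f` is positive definite on `ℂ³`: applying `f` to the entries of the Gram matrix of a finite
family of vectors `(xᵣ, yᵣ, wᵣ)` gives a positive semidefinite form. -/
def PosDefOnC3 (f : ℂ → ℂ) : Prop :=
  ∀ (n : ℕ) (x y w c : Fin n → ℂ), 0 ≤ ∑ r, ∑ s, c r * conj (c s) *
    f (x r * conj (x s) + y r * conj (y s) + w r * conj (w s))

lemma norm_le_of_forall_norm_eq_one {B : ℂ} {D : ℝ}
    (h : ∀ α : ℂ, ‖α‖ = 1 → 0 ≤ D + (α * B).re) : ‖B‖ ≤ D := by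
  rcases eq_or_ne B 0 with rfl | hB
  · simpa using h 1 (by simp)
  · have hn : (‖B‖ : ℂ) ≠ 0 := by simpa using hB
    have h1 := h (-(conj B / ‖B‖)) (by simp [hB])
    have h2 : -(conj B / ‖B‖) * B = -((‖B‖ : ℝ) : ℂ) := by
      rw [neg_mul, div_mul_eq_mul_div, mul_comm, Complex.mul_conj, Complex.normSq_eq_norm_sq]
      push_cast
      field_simp
    rw [h2, Complex.neg_re, Complex.ofReal_re] at h1
    linarith

lemma Complex.ofReal_sqrt_mul_conj {a : ℝ} (ha : 0 ≤ a) :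
    ((√a : ℝ) : ℂ) * conj ((√a : ℝ) : ℂ) = a := by
  rw [Complex.conj_ofReal, ← Complex.ofReal_mul, Real.mul_self_sqrt ha]

lemma Complex.exists_mul_conj_eq (w : ℂ) :
    ∃ x y : ℂ, x * conj x = (‖w‖ : ℝ) ∧ y * conj y = (‖w‖ : ℝ) ∧ x * conj y = w := by
  have hr := Complex.ofReal_sqrt_mul_conj (norm_nonneg w)
  rcases eq_or_ne w 0 with rfl | hw
  · exact ⟨0, 0, by simp⟩
  · have hn : ((√‖w‖ : ℝ) : ℂ) ≠ 0 := by simpa using hw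
    refine ⟨w / (√‖w‖ : ℝ), (√‖w‖ : ℝ), ?_, hr, ?_⟩
    · rw [map_div₀, div_mul_div_comm, hr, Complex.mul_conj, Complex.normSq_eq_norm_sq]
      push_cast
      have : (‖w‖ : ℂ) ≠ 0 := by simpa using hw
      field_simp
    · rw [Complex.conj_ofReal]
      field_simp

namespace PosDefOnC3

variable {f : ℂ → ℂ}

lemma sum_nonneg (hf : PosDefOnC3 f) {ι : Type*} [Fintype ι] (x y w c : ι → ℂ) :
    0 ≤ ∑ r, ∑ s, c r * conj (c s) *
      f (x r * conj (x s) + y r * conj (y s) + w r * conj (w s)) := by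
  let e := (Fintype.equivFin ι).symm
  have h := hf _ (x ∘ e) (y ∘ e) (w ∘ e) (c ∘ e)
  simp only [Function.comp] at h
  rwa [e.sum_comp fun r => ∑ s, c r * conj (c (e s)) * f (x r * conj (x (e s)) +
    y r * conj (y (e s)) + w r * conj (w (e s))),
    Finset.sum_congr rfl fun r _ => e.sum_comp fun s => c r * conj (c s) *
      f (x r * conj (x s) + y r * conj (y s) + w r * conj (w s))] at h

lemma apply_ofReal_nonneg (hf : PosDefOnC3 f) {a : ℝ} (ha : 0 ≤ a) : 0 ≤ f a := by
  have h := hf 1 (fun _ => (√a : ℝ)) 0 0 1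
  simpa [-Complex.conj_ofReal, Complex.ofReal_sqrt_mul_conj ha] using h

lemma ofReal_re_apply (hf : PosDefOnC3 f) {a : ℝ} (ha : 0 ≤ a) : ((f a).re : ℂ) = f a :=
  (Complex.eq_re_of_ofReal_le (r := 0) (by simpa using hf.apply_ofReal_nonneg ha)).symm

lemma apply_conj (hf : PosDefOnC3 f) (z : ℂ) : f (conj z) = conj (f z) := by
  have hzz := (Complex.nonneg_iff.1 (hf.apply_ofReal_nonneg (Complex.normSq_nonneg z))).2
  have h11 := (Complex.nonneg_iff.1 (hf.apply_ofReal_nonneg zero_le_one)).2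
  have h1 := hf 2 ![z, 1] 0 0 ![1, 1]
  have h2 := hf 2 ![z, 1] 0 0 ![1, Complex.I]
  simp only [Fin.sum_univ_two, Matrix.cons_val_zero, Matrix.cons_val_one, Pi.zero_apply, map_one,
    map_zero, mul_one, one_mul, mul_zero, add_zero, Complex.mul_conj, Complex.conj_I] at h1 h2
  have h1' := (Complex.nonneg_iff.1 h1).2
  have h2' := (Complex.nonneg_iff.1 h2).2
  simp at h1' h2' h11
  apply Complex.ext
  · simp; linarith
  · simp; linarith

lemma re_apply_mono (hf : PosDefOnC3 f) {a s : ℝ} (ha : 0 ≤ a) (hs : 0 ≤ s) :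
    (f a).re ≤ (f ↑(a + s)).re := by
  have h := hf 2 (fun _ => (√a : ℝ)) ![0, (√s : ℝ)] 0 ![1, -1]
  simp only [Fin.sum_univ_two, Matrix.cons_val_zero, Matrix.cons_val_one, Pi.zero_apply, map_one,
    map_zero, map_neg, mul_one, one_mul, mul_zero, zero_mul, add_zero,
    Complex.ofReal_sqrt_mul_conj ha, Complex.ofReal_sqrt_mul_conj hs] at h
  have h' := (Complex.nonneg_iff.1 h).1
  simp at h'
  push_cast
  linarith

lemma re_apply_superadd (hf : PosDefOnC3 f) {a s t : ℝ} (ha : 0 ≤ a) (hs : 0 ≤ s) (ht : 0 ≤ t) :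
    0 ≤ (f ↑(a + s + t)).re - (f ↑(a + s)).re - (f ↑(a + t)).re + (f a).re := by
  have h := hf 4 (fun _ => (√a : ℝ)) ![0, (√s : ℝ), 0, (√s : ℝ)] ![0, 0, (√t : ℝ), (√t : ℝ)]
    ![1, -1, -1, 1]
  simp only [Fin.sum_univ_four, Matrix.cons_val, map_one,
    map_zero, map_neg, mul_one, one_mul, mul_zero, zero_mul, add_zero,
    Complex.ofReal_sqrt_mul_conj ha, Complex.ofReal_sqrt_mul_conj hs,
    Complex.ofReal_sqrt_mul_conj ht] at h
  have h' := (Complex.nonneg_iff.1 h).1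
  simp at h'
  push_cast
  linarith

lemma norm_apply_add_sub_le (hf : PosDefOnC3 f) {a : ℝ} (ha : 0 ≤ a) (w : ℂ) :
    ‖f (a + w) - f a‖ ≤ (f ↑(a + ‖w‖)).re - (f a).re := by
  obtain ⟨x, y, hx, hy, hxy⟩ := Complex.exists_mul_conj_eq w
  have hyx : y * conj x = conj w := by rw [← hxy]; simp [mul_comm]
  have hconj : f (a + conj w) = conj (f (a + w)) := by
    rw [← hf.apply_conj]; simp
  refine norm_le_of_forall_norm_eq_one fun α hα => ?_
  have h := hf 3 (fun _ => (√a : ℝ)) ![0, x, y] 0 ![-α - 1, α, 1]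
  have hαα : α * conj α = 1 := by
    rw [Complex.mul_conj, Complex.normSq_eq_norm_sq, hα]; simp
  simp only [Fin.sum_univ_three, Matrix.cons_val, Pi.zero_apply, map_one,
    map_zero, map_neg, map_sub, mul_one, one_mul, mul_zero, zero_mul, add_zero,
    Complex.ofReal_sqrt_mul_conj ha, hx, hy, hxy, hyx, hαα, hconj] at h
  have hsum : (0 : ℂ) ≤ 2 * (f (a + (‖w‖ : ℝ)) - f a) + α * (f (a + w) - f a) +
      conj α * (conj (f (a + w)) - f a) := by
    refine h.trans_eq ?_
    linear_combination (-(f a)) * hαα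
  have hre := (Complex.nonneg_iff.1 hsum).1
  have hfa : conj (f a) = f a := by rw [← hf.ofReal_re_apply ha, Complex.conj_ofReal]
  have hre2 : (conj α * (conj (f (a + w)) - f a)).re = (α * (f (a + w) - f a)).re := by
    rw [← Complex.conj_re, map_mul, map_sub, Complex.conj_conj, Complex.conj_conj, hfa]
  rw [Complex.add_re, Complex.add_re, hre2] at hre
  push_cast
  simp only [Complex.mul_re, Complex.sub_re, Complex.re_ofNat, Complex.im_ofNat] at hre ⊢
  linarith

lemma tendsto_re_apply_add (hf : PosDefOnC3 f) {a : ℝ} (ha : 0 ≤ a) :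
    Tendsto (fun s : ℝ => (f ↑(a + s)).re - (f a).re) (𝓝[≥] 0) (𝓝 0) := by
  set D : ℝ → ℝ := fun s => (f ↑(a + s)).re - (f a).re with hD
  have hsup : ∀ n : ℕ, ∀ s, 0 ≤ s → n * D s ≤ D (n * s) := by
    intro n s hs
    induction n with
    | zero => simp [hD]
    | succ n ih =>
      have h := hf.re_apply_superadd ha (mul_nonneg n.cast_nonneg hs : 0 ≤ (n : ℝ) * s) hs
      push_cast
      rw [add_mul, add_mul, one_mul, one_mul]
      refine (add_le_add_left ih _).trans ?_
      simp only [hD]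
      rw [← add_assoc]
      linarith
  have hmono : ∀ s t, 0 ≤ s → s ≤ t → D s ≤ D t := by
    intro s t hs hst
    have := hf.re_apply_mono (add_nonneg ha hs) (sub_nonneg.2 hst)
    rw [show a + s + (t - s) = a + t by ring] at this
    simp only [hD]
    linarith
  have h0 : ∀ s, 0 ≤ s → 0 ≤ D s := fun s hs => by
    have := hmono 0 s le_rfl hs
    simpa [hD] using this
  rw [Metric.tendsto_nhdsWithin_nhds]
  intro ε hε
  obtain ⟨n, hn⟩ := exists_nat_gt (D 1 / ε)
  have hn0 : (0 : ℝ) < n := lt_of_le_of_lt (div_nonneg (h0 1 zero_le_one) hε.le) hn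
  refine ⟨1 / n, by positivity, fun s hs hs' => ?_⟩
  have hs0 : 0 ≤ s := hs
  rw [Real.dist_eq, sub_zero, abs_of_nonneg hs0] at hs'
  rw [Real.dist_eq, sub_zero, abs_of_nonneg (h0 s hs0)]
  have h1 : n * D s ≤ D 1 := (hsup n s hs0).trans
    (hmono _ _ (by positivity) (by rw [lt_div_iff₀ hn0] at hs'; linarith))
  rw [div_lt_iff₀ hε] at hn
  nlinarith

lemma continuousAt_ofReal (hf : PosDefOnC3 f) {a : ℝ} (ha : 0 ≤ a) : ContinuousAt f a := by
  rw [ContinuousAt, tendsto_iff_norm_sub_tendsto_zero]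
  have hw : Tendsto (fun z : ℂ => ‖z - a‖) (𝓝 (a : ℂ)) (𝓝[≥] 0) := by
    refine tendsto_nhdsWithin_iff.2 ⟨?_, Eventually.of_forall fun z => norm_nonneg _⟩
    have : Tendsto (fun z : ℂ => ‖z - a‖) (𝓝 (a : ℂ)) (𝓝 ‖(a : ℂ) - a‖) :=
      ((continuous_id.sub continuous_const).norm).tendsto _
    simpa using this
  refine squeeze_zero (fun _ => norm_nonneg _) (fun z => ?_) ((hf.tendsto_re_apply_add ha).comp hw)
  simpa using hf.norm_apply_add_sub_le ha (z - a)

lemma norm_apply_sub_sq_le (hf : PosDefOnC3 f) (z w : ℂ) :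
    ‖f z - f w‖ ^ 2 ≤ (f 1).re *
      (f (z * conj z) - f (z * conj w) - f (w * conj z) + f (w * conj w)).re := by
  set E := (f (z * conj z) - f (z * conj w) - f (w * conj z) + f (w * conj w)).re with hE
  have key : ∀ α : ℂ, 0 ≤ ‖α‖ ^ 2 * (f 1).re + 2 * (conj α * (f z - f w)).re + E := by
    intro α
    have h := hf 3 ![z, w, 1] 0 0 ![1, -1, α]
    simp only [Fin.sum_univ_three, Matrix.cons_val, Pi.zero_apply, map_one,
      map_zero, map_neg, mul_one, one_mul, mul_zero, add_zero, hf.apply_conj] at h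
    have hαα : α * conj α = ((‖α‖ ^ 2 : ℝ) : ℂ) := by
      rw [Complex.mul_conj, Complex.normSq_eq_norm_sq]
    rw [hαα] at h
    have hre := (Complex.nonneg_iff.1 h).1
    simp only [Complex.add_re, Complex.mul_re, Complex.neg_re, Complex.neg_im, Complex.one_re,
      Complex.one_im, Complex.ofReal_re, Complex.ofReal_im, Complex.conj_re, Complex.conj_im,
      Complex.mul_im, Complex.sub_re, Complex.sub_im] at hre ⊢
    simp only [hE, Complex.add_re, Complex.sub_re]
    linarith
  have hquad : ∀ t : ℝ, 0 ≤ (f 1).re * (t * t) + (-2 * ‖f z - f w‖) * t + E := by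
    intro t
    rcases eq_or_ne (f z - f w) 0 with h0 | h0
    · have := key t
      rw [h0] at this ⊢
      simp at this ⊢
      nlinarith
    · have hn : (‖f z - f w‖ : ℂ) ≠ 0 := by simpa using h0
      have := key (-(t * (f z - f w) / ‖f z - f w‖))
      have h2 : conj (-(t * (f z - f w) / ‖f z - f w‖)) * (f z - f w) =
          ((-(t * ‖f z - f w‖) : ℝ) : ℂ) := by
        have h3 : conj (f z - f w) * (f z - f w) = (‖f z - f w‖ : ℂ) ^ 2 := by
          rw [mul_comm, Complex.mul_conj, Complex.normSq_eq_norm_sq]; push_cast; rfl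
        rw [map_neg, map_div₀, map_mul, Complex.conj_ofReal, Complex.conj_ofReal]
        push_cast
        field_simp
        linear_combination -(t : ℂ) * h3
      have h4 : ‖-((t : ℂ) * (f z - f w) / ‖f z - f w‖)‖ ^ 2 = t * t := by
        rw [norm_neg, norm_div, norm_mul, Complex.norm_real, Complex.norm_real, norm_norm,
          mul_div_assoc, div_self (by simpa using h0), mul_one, Real.norm_eq_abs, sq_abs, sq]
      rw [h2, h4, Complex.ofReal_re] at this
      linarith
  have := discrim_le_zero hquad
  rw [discrim] at this
  nlinarith

lemma continuous (hf : PosDefOnC3 f) : Continuous f := by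
  rw [continuous_iff_continuousAt]
  intro z
  rw [ContinuousAt, tendsto_iff_norm_sub_tendsto_zero]
  set E : ℂ → ℝ := fun w =>
    (f (w * conj w) - f (w * conj z) - f (z * conj w) + f (z * conj z)).re with hE
  have hnorm : ContinuousAt f (z * conj z) := by
    rw [Complex.mul_conj]; exact hf.continuousAt_ofReal (Complex.normSq_nonneg z)
  have hlim : Tendsto E (𝓝 z) (𝓝 (E z)) := by
    have h1 : Tendsto (fun w => f (w * conj w)) (𝓝 z) (𝓝 (f (z * conj z))) :=
      hnorm.tendsto.comp ((continuous_id.mul Complex.continuous_conj).tendsto z)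
    have h2 : Tendsto (fun w => f (w * conj z)) (𝓝 z) (𝓝 (f (z * conj z))) :=
      hnorm.tendsto.comp ((continuous_id.mul continuous_const).tendsto z)
    have h3 : Tendsto (fun w => f (z * conj w)) (𝓝 z) (𝓝 (f (z * conj z))) :=
      hnorm.tendsto.comp ((continuous_const.mul Complex.continuous_conj).tendsto z)
    exact (Complex.continuous_re.tendsto _).comp (((h1.sub h2).sub h3).add tendsto_const_nhds)
  have hEz : E z = 0 := by simp [hE]
  rw [hEz] at hlim
  have hlim2 : Tendsto (fun w => √((f 1).re * E w)) (𝓝 z) (𝓝 0) := by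
    have := (Real.continuous_sqrt.tendsto _).comp (hlim.const_mul (f 1).re)
    simpa [Function.comp_def] using this
  exact squeeze_zero (fun _ => norm_nonneg _)
    (fun w => Real.le_sqrt_of_sq_le (hf.norm_apply_sub_sq_le w z)) hlim2

end PosDefOnC3

lemma fwdDiff_iter_re_add (u : ℝ → ℂ) (v : ℝ → ℝ) (α : ℂ) (n : ℕ) (h x : ℝ) :
    (fwdDiff h)^[n] (fun t => v t + (α * u t).re) x =
      (fwdDiff h)^[n] v x + (α * (fwdDiff h)^[n] u x).re := by
  simp only [fwdDiff_iter_eq_sum_shift, smul_add, Finset.sum_add_distrib, Finset.mul_sum,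
    Complex.re_sum, mul_smul_comm]
  congr 1
  exact Finset.sum_congr rfl fun k _ => (map_zsmul Complex.reAddGroupHom
    ((-1) ^ (n - k) * (n.choose k : ℤ)) (α * u (x + k • h))).symm

namespace PosDefOnC3

variable {f : ℂ → ℂ}

lemma sum_nonneg_add_mul (hf : PosDefOnC3 f) {κ : Type*} [Fintype κ] (d z ρ : κ → ℂ) {a : ℝ}
    (ha : 0 ≤ a) {m : ℕ} (x c : Fin m → ℝ) :
    0 ≤ ∑ i, ∑ j, ((c i * c j : ℝ) : ℂ) * ∑ p, ∑ q, d p * conj (d q) *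
      f (z p * conj (z q) + ρ p * conj (ρ q) * ((a + x i * x j : ℝ) : ℂ)) := by
  refine (hf.sum_nonneg (ι := Fin m × κ) (fun i => z i.2) (fun i => (√a : ℝ) * ρ i.2)
    (fun i => x i.1 * ρ i.2) (fun i => c i.1 * d i.2)).trans_eq ?_
  simp only [Fintype.sum_prod_type, Finset.mul_sum]
  refine Finset.sum_congr rfl fun i _ => ?_
  rw [Finset.sum_comm]
  refine Finset.sum_congr rfl fun j _ => Finset.sum_congr rfl fun p _ =>
    Finset.sum_congr rfl fun q _ => ?_
  have hsq := Complex.ofReal_sqrt_mul_conj ha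
  rw [Complex.conj_ofReal] at hsq
  simp only [map_mul, Complex.conj_ofReal]
  rw [show (z p * conj (z q) + (√a : ℝ) * ρ p * ((√a : ℝ) * conj (ρ q)) +
      x i * ρ p * (x j * conj (ρ q)) : ℂ) =
      z p * conj (z q) + ρ p * conj (ρ q) * ((a + x i * x j : ℝ) : ℂ) by
    push_cast
    linear_combination ρ p * conj (ρ q) * hsq]
  push_cast
  ring

lemma exists_hasSum_ray (hf : PosDefOnC3 f) (z₁ z₂ ρ₁ ρ₂ : ℂ) :
    ∃ (p : ℕ → ℂ) (q : ℕ → ℝ), (∀ k, ‖p k‖ ≤ q k) ∧ ∀ t : ℝ, 0 ≤ t →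
      HasSum (fun k => q k * t ^ k) (((f (z₁ * conj z₁ + ρ₁ * conj ρ₁ * t)).re +
        (f (z₂ * conj z₂ + ρ₂ * conj ρ₂ * t)).re) / 2) ∧
      HasSum (fun k => p k * (t : ℂ) ^ k) (f (z₁ * conj z₂ + ρ₁ * conj ρ₂ * t)) := by
  have hc := hf.continuous
  refine exists_hasSum_of_norm_fwdDiff_le
    (u := fun t : ℝ => f (z₁ * conj z₂ + ρ₁ * conj ρ₂ * t))
    (v := fun t : ℝ => ((f (z₁ * conj z₁ + ρ₁ * conj ρ₁ * t)).re +
        (f (z₂ * conj z₂ + ρ₂ * conj ρ₂ * t)).re) / 2) (by fun_prop) (by fun_prop) ?_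
  intro n h hh
  refine norm_le_of_forall_norm_eq_one fun α hα => ?_
  rw [← fwdDiff_iter_re_add]
  refine fwdDiff_iter_nonneg_of_quadratic_form (by fun_prop) ?_ n hh
  intro a ha m x c _
  have hαα : α * conj α = 1 := by
    rw [Complex.mul_conj, Complex.normSq_eq_norm_sq, hα]; simp
  have key := hf.sum_nonneg_add_mul ![α, 1] ![z₁, z₂] ![ρ₁, ρ₂] ha x c
  have hre := (Complex.nonneg_iff.1 key).1
  rw [Complex.re_sum] at hre
  simp only [Complex.re_sum, Complex.re_ofReal_mul] at hre
  have hstep : ∀ t : ℝ, (∑ p, ∑ q, ![α, 1] p * conj (![α, 1] q) *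
      f (![z₁, z₂] p * conj (![z₁, z₂] q) + ![ρ₁, ρ₂] p * conj (![ρ₁, ρ₂] q) * t)).re =
      2 * (((f (z₁ * conj z₁ + ρ₁ * conj ρ₁ * t)).re +
        (f (z₂ * conj z₂ + ρ₂ * conj ρ₂ * t)).re) / 2 +
        (α * f (z₁ * conj z₂ + ρ₁ * conj ρ₂ * t)).re) := by
    intro t
    have h21 : f (z₂ * conj z₁ + ρ₂ * conj ρ₁ * t) = conj (f (z₁ * conj z₂ + ρ₁ * conj ρ₂ * t)) := by
      rw [← hf.apply_conj]
      congr 1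
      simp [mul_comm]
    simp only [Fin.sum_univ_two, Matrix.cons_val_zero, Matrix.cons_val_one, map_one, mul_one,
      one_mul, hαα, h21]
    rw [← map_mul]
    simp only [Complex.add_re, Complex.conj_re]
    simp
    ring
  simp only [← Complex.re_sum, hstep] at hre
  have : ∑ i, ∑ j, c i * c j * (2 * (((f (z₁ * conj z₁ + ρ₁ * conj ρ₁ * (a + x i * x j : ℝ))).re +
        (f (z₂ * conj z₂ + ρ₂ * conj ρ₂ * (a + x i * x j : ℝ))).re) / 2 +
        (α * f (z₁ * conj z₂ + ρ₁ * conj ρ₂ * (a + x i * x j : ℝ))).re)) =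
      2 * ∑ i, ∑ j, c i * c j * (((f (z₁ * conj z₁ + ρ₁ * conj ρ₁ * (a + x i * x j : ℝ))).re +
        (f (z₂ * conj z₂ + ρ₂ * conj ρ₂ * (a + x i * x j : ℝ))).re) / 2 +
        (α * f (z₁ * conj z₂ + ρ₁ * conj ρ₂ * (a + x i * x j : ℝ))).re) := by
    simp only [Finset.mul_sum]
    refine Finset.sum_congr rfl fun i _ => Finset.sum_congr rfl fun j _ => by ring
  rw [this] at hre
  linarith

end PosDefOnC3

lemma isBigO_sub_sum_of_hasSum {p : ℕ → ℂ} {u : ℝ → ℂ}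
    (hu : ∀ t : ℝ, 0 ≤ t → HasSum (fun k => p k * (t : ℂ) ^ k) (u t)) (n : ℕ) :
    (fun t => u t - ∑ k ∈ Finset.range n, p k * (t : ℂ) ^ k) =O[𝓝[>] 0]
      fun t : ℝ => t ^ n := by
  have hs : Summable fun k => ‖p k‖ := by
    simpa using (hu 1 zero_le_one).summable.norm
  refine IsBigO.of_bound (∑' k, ‖p (k + n)‖) ?_
  filter_upwards [Ioo_mem_nhdsGT (zero_lt_one (α := ℝ))] with t ht
  have h := (hasSum_nat_add_iff' n).2 (hu t ht.1.le)
  rw [← h.tsum_eq, Real.norm_eq_abs, abs_of_nonneg (pow_nonneg ht.1.le n), ← tsum_mul_right]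
  refine tsum_of_norm_bounded (((summable_nat_add_iff n).2 hs).mul_right _).hasSum fun k => ?_
  rw [norm_mul, norm_pow, Complex.norm_real, Real.norm_eq_abs, abs_of_nonneg ht.1.le]
  exact mul_le_mul_of_nonneg_left (pow_le_pow_of_le_one ht.1.le ht.2.le (by omega)) (norm_nonneg _)

lemma isLittleO_sub_sum_of_hasSum {p : ℕ → ℂ} {u : ℝ → ℂ}
    (hu : ∀ t : ℝ, 0 ≤ t → HasSum (fun k => p k * (t : ℂ) ^ k) (u t)) (n : ℕ) :
    (fun t => u t - ∑ k ∈ Finset.range (n + 1), p k * (t : ℂ) ^ k) =o[𝓝[>] 0]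
      fun t : ℝ => t ^ n := by
  refine (isBigO_sub_sum_of_hasSum hu (n + 1)).trans_isLittleO ?_
  exact (isLittleO_pow_pow n.lt_succ_self).mono nhdsWithin_le_nhds

lemma eq_zero_of_hasSum_zero {p : ℕ → ℂ}
    (hp : ∀ t : ℝ, 0 ≤ t → HasSum (fun k => p k * (t : ℂ) ^ k) 0) (n : ℕ) : p n = 0 := by
  induction n using Nat.strong_induction_on with
  | _ n ih =>
    have h := isLittleO_sub_sum_of_hasSum hp n
    rw [isLittleO_iff] at h
    by_contra hn
    obtain ⟨t, ht, ht0⟩ := ((h (half_pos (norm_pos_iff.2 hn))).and self_mem_nhdsWithin).exists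
    have ht0 : 0 < t := ht0
    rw [Finset.sum_range_succ, Finset.sum_eq_zero fun k hk => by
      rw [ih k (Finset.mem_range.1 hk), zero_mul]] at ht
    have hpos : 0 < t ^ n := pow_pos ht0 n
    simp only [zero_add, zero_sub, norm_neg, norm_mul, norm_pow, Complex.norm_real,
      Real.norm_eq_abs, abs_of_pos ht0] at ht
    nlinarith [mul_pos (norm_pos_iff.2 hn) hpos]

lemma eq_of_hasSum_of_hasSum {p p' : ℕ → ℂ} {u : ℝ → ℂ}
    (hp : ∀ t : ℝ, 0 ≤ t → HasSum (fun k => p k * (t : ℂ) ^ k) (u t))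
    (hp' : ∀ t : ℝ, 0 ≤ t → HasSum (fun k => p' k * (t : ℂ) ^ k) (u t)) (n : ℕ) : p n = p' n := by
  refine sub_eq_zero.1 (eq_zero_of_hasSum_zero (p := fun k => p k - p' k) (fun t ht => ?_) n)
  simpa [sub_mul] using (hp t ht).sub (hp' t ht)

namespace PosDefOnC3

variable {f : ℂ → ℂ}

lemma of_hasSum (hf : PosDefOnC3 f) {F : ℕ → ℂ → ℂ}
    (hF : ∀ z (t : ℝ), 0 ≤ t → HasSum (fun k => F k z * (t : ℂ) ^ k) (f (t * z))) (k : ℕ) :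
    PosDefOnC3 (F k) := by
  intro n x y w c
  set G : Fin n → Fin n → ℂ :=
    fun r s => x r * conj (x s) + y r * conj (y s) + w r * conj (w s) with hG
  set u : ℝ → ℂ := fun t => ∑ r, ∑ s, c r * conj (c s) * f (t * G r s) with hu
  set p : ℕ → ℂ := fun k => ∑ r, ∑ s, c r * conj (c s) * F k (G r s) with hp
  have hsum : ∀ t : ℝ, 0 ≤ t → HasSum (fun k => p k * (t : ℂ) ^ k) (u t) := by
    intro t ht
    simp only [hp, Finset.sum_mul]
    refine hasSum_sum fun r _ => hasSum_sum fun s _ => ?_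
    simpa only [mul_assoc] using (hF (G r s) t ht).mul_left (c r * conj (c s))
  have hpos : ∀ (a : ℝ), 0 ≤ a → ∀ m (ξ γ : Fin m → ℝ),
      0 ≤ ∑ i, ∑ j, ((γ i * γ j : ℝ) : ℂ) * u (a * (ξ i * ξ j)) := by
    intro a ha m ξ γ
    have hsq := Complex.ofReal_sqrt_mul_conj ha
    rw [Complex.conj_ofReal] at hsq
    refine (hf.sum_nonneg (ι := Fin m × Fin n) (fun i => (√a : ℝ) * ξ i.1 * x i.2)
      (fun i => (√a : ℝ) * ξ i.1 * y i.2) (fun i => (√a : ℝ) * ξ i.1 * w i.2)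
      (fun i => γ i.1 * c i.2)).trans_eq ?_
    simp only [Fintype.sum_prod_type, hu, Finset.mul_sum]
    refine Finset.sum_congr rfl fun i _ => ?_
    rw [Finset.sum_comm]
    refine Finset.sum_congr rfl fun j _ => Finset.sum_congr rfl fun r _ =>
      Finset.sum_congr rfl fun s _ => ?_
    simp only [map_mul, Complex.conj_ofReal, hG]
    rw [show ∀ X Y W X' Y' W' : ℂ, (√a : ℝ) * ξ i * X * ((√a : ℝ) * ξ j * X') +
      (√a : ℝ) * ξ i * Y * ((√a : ℝ) * ξ j * Y') + (√a : ℝ) * ξ i * W * ((√a : ℝ) * ξ j * W') =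
      ((a * (ξ i * ξ j) : ℝ) : ℂ) * (X * X' + Y * Y' + W * W') by
        intro X Y W X' Y' W'
        push_cast
        linear_combination ξ i * ξ j * (X * X' + Y * Y' + W * W') * hsq]
    push_cast
    ring
  have hnn : ∀ t : ℝ, 0 ≤ t → 0 ≤ u t := by
    intro t ht
    simpa using hpos t ht 1 1 1
  rw [show ∑ r, ∑ s, c r * conj (c s) * F k (G r s) = p k from rfl, Complex.nonneg_iff]
  constructor
  · refine coeff_nonneg_of_isLittleO (u := fun t => (u t).re) (p := fun k => (p k).re) (n := k)
      ?_ fun m ξ γ hξ => ?_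
    · have h := isLittleO_sub_sum_of_hasSum hsum k
      refine (IsBigO.of_bound 1 (Eventually.of_forall fun t => ?_)).trans_isLittleO h
      rw [one_mul]
      refine le_trans (le_of_eq ?_) (Complex.abs_re_le_norm _)
      simp [← Complex.ofReal_pow]
    · filter_upwards [self_mem_nhdsWithin] with ε hε
      have h := (Complex.nonneg_iff.1 (hpos ε (le_of_lt hε) m ξ γ)).1
      simpa only [Complex.re_sum, Complex.re_ofReal_mul, ← Complex.ofReal_mul] using h
  · have h := eq_of_hasSum_of_hasSum (p := fun k => conj (p k)) (u := u) (fun t ht => ?_) hsum k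
    · exact (Complex.conj_eq_iff_im.1 h).symm
    · have hut : conj (u t) = u t :=
        Complex.conj_eq_iff_im.2 (Complex.nonneg_iff.1 (hnn t ht)).2.symm
      simpa [hut] using Complex.hasSum_conj'.2 (hsum t ht)

lemma exists_homogeneous (hf : PosDefOnC3 f) : ∃ F : ℕ → ℂ → ℂ, (∀ k, PosDefOnC3 (F k)) ∧
    (∀ k z (t : ℝ), 0 ≤ t → F k (t * z) = t ^ k * F k z) ∧ ∀ z, HasSum (fun k => F k z) (f z) := by
  have h : ∀ z, ∃ p : ℕ → ℂ, ∀ t : ℝ, 0 ≤ t →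
      HasSum (fun k => p k * (t : ℂ) ^ k) (f (t * z)) := by
    intro z
    obtain ⟨p, q, -, h⟩ := hf.exists_hasSum_ray 0 0 z 1
    exact ⟨p, fun t ht => by simpa [mul_comm] using (h t ht).2⟩
  choose p hp using h
  refine ⟨fun k z => p z k, hf.of_hasSum hp, fun k z t ht => ?_, fun z => by
    simpa using hp z 1 zero_le_one⟩
  refine eq_of_hasSum_of_hasSum (p' := fun k => (t : ℂ) ^ k * p z k) (hp (t * z)) (fun s hs => ?_) k
  have := hp z (s * t) (mul_nonneg hs ht)
  convert this using 1
  · ext k; push_cast; ring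
  · push_cast; ring_nf

end PosDefOnC3

lemma eq_zero_of_forall_mul_pow_le {q C : ℝ} {j k : ℕ} (hq : 0 ≤ q) (hjk : j < k)
    (h : ∀ t : ℝ, 1 ≤ t → q * t ^ k ≤ C * t ^ j) : q = 0 := by
  by_contra hne
  have hq' : 0 < q := lt_of_le_of_ne hq (Ne.symm hne)
  have hC : q ≤ C := by simpa using h 1 le_rfl
  set t := C / q + 1 with ht
  have ht1 : 1 ≤ t := by
    have : 0 ≤ C / q := div_nonneg (hq.trans hC) hq
    linarith
  have h1 : q * t ^ (j + 1) ≤ C * t ^ j :=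
    (mul_le_mul_of_nonneg_left (pow_le_pow_right₀ ht1 hjk) hq).trans (h t ht1)
  have h2 : 0 < t ^ j := by positivity
  have h3 : q * t ≤ C := by
    rw [pow_succ] at h1
    nlinarith
  have h4 : q * t = C + q := by rw [ht]; field_simp
  linarith

lemma exists_polynomial_of_forall_ray {φ : ℝ → ℂ} {j : ℕ}
    (h : ∀ s : ℝ, ∃ A : Polynomial ℂ, A.natDegree ≤ j ∧
      ∀ t : ℝ, 0 ≤ t → φ (s + t) = A.eval (t : ℂ)) :
    ∃ A : Polynomial ℂ, A.natDegree ≤ j ∧ ∀ t : ℝ, φ t = A.eval (t : ℂ) := by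
  obtain ⟨A, hA, hφ⟩ := h 0
  refine ⟨A, hA, fun s => ?_⟩
  obtain ⟨B, -, hB⟩ := h s
  have hAB : B = A.comp (Polynomial.X + Polynomial.C (s : ℂ)) := by
    refine Polynomial.eq_of_infinite_eval_eq _ _ (Set.Infinite.mono ?_
      ((Set.Ici_infinite (max 0 (-s))).image Complex.ofReal_injective.injOn))
    rintro _ ⟨t, ht, rfl⟩
    have ht : max 0 (-s) ≤ t := ht
    have h1 := hB t ((le_max_left _ _).trans ht)
    have h2 := hφ (s + t) (by linarith [(le_max_right _ _).trans ht])
    rw [zero_add, h1] at h2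
    simpa [add_comm] using h2
  have h1 := hB 0 le_rfl
  rw [hAB] at h1
  simpa using h1

namespace PosDefOnC3

variable {F : ℂ → ℂ} {j : ℕ}

lemma exists_polynomial_ray (hF : PosDefOnC3 F)
    (hom : ∀ z (t : ℝ), 0 ≤ t → F (t * z) = t ^ j * F z) (z ρ : ℂ) :
    ∃ A : Polynomial ℂ, A.natDegree ≤ j ∧
      ∀ t : ℝ, 0 ≤ t → F (z + ρ * t) = A.eval (t : ℂ) := by
  obtain ⟨p, q, hpq, h⟩ := hF.exists_hasSum_ray z 1 ρ 1
  have hq0 : ∀ k, 0 ≤ q k := fun k => (norm_nonneg _).trans (hpq k)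
  have h1 : 0 ≤ (F 1).re := (Complex.nonneg_iff.1 (by
    simpa using hF.apply_ofReal_nonneg zero_le_one)).1
  have hreal : ∀ s : ℝ, 0 ≤ s → (F s).re = s ^ j * (F 1).re := by
    intro s hs
    rw [← mul_one (s : ℂ), hom 1 s hs, ← Complex.ofReal_pow, Complex.re_ofReal_mul]
  have hq : ∀ k, j < k → q k = 0 := by
    intro k hk
    refine eq_zero_of_forall_mul_pow_le
      (C := (F 1).re * ((Complex.normSq z + Complex.normSq ρ) ^ j + 2 ^ j)) (hq0 k) hk
      fun t ht => ?_
    have ht0 : 0 ≤ t := zero_le_one.trans ht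
    have hz := Complex.normSq_nonneg z
    have hρ := Complex.normSq_nonneg ρ
    have h2 := le_hasSum (h t ht0).1 k fun i _ => mul_nonneg (hq0 i) (pow_nonneg ht0 i)
    rw [Complex.mul_conj, Complex.mul_conj, map_one, mul_one, one_mul, ← Complex.ofReal_mul,
      ← Complex.ofReal_add, ← Complex.ofReal_one, ← Complex.ofReal_add,
      hreal _ (by positivity), hreal _ (by positivity)] at h2
    have h3 : (Complex.normSq z + Complex.normSq ρ * t) ^ j ≤
        (Complex.normSq z + Complex.normSq ρ) ^ j * t ^ j := by
      rw [← mul_pow]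
      exact pow_le_pow_left₀ (by positivity) (by nlinarith) j
    have h4 : (1 + t) ^ j ≤ 2 ^ j * t ^ j := by
      rw [← mul_pow]
      exact pow_le_pow_left₀ (by positivity) (by linarith) j
    have h5 : 0 ≤ (Complex.normSq z + Complex.normSq ρ * t) ^ j := by positivity
    have h6 : 0 ≤ (1 + t) ^ j := by positivity
    nlinarith [mul_le_mul_of_nonneg_right h3 h1, mul_le_mul_of_nonneg_right h4 h1,
      mul_nonneg h5 h1, mul_nonneg h6 h1]
  have hp : ∀ k, j < k → p k = 0 := fun k hk =>
    norm_le_zero_iff.1 ((hpq k).trans (hq k hk).le)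
  refine ⟨∑ k ∈ Finset.range (j + 1), Polynomial.C (p k) * Polynomial.X ^ k, ?_, fun t ht => ?_⟩
  · refine Polynomial.natDegree_sum_le_of_forall_le _ _ fun k hk => ?_
    exact (Polynomial.natDegree_C_mul_X_pow_le _ _).trans
      (Nat.lt_succ_iff.1 (Finset.mem_range.1 hk))
  · have h2 := (h t ht).2
    simp only [map_one, mul_one] at h2
    simp only [Polynomial.eval_finsetSum, Polynomial.eval_mul, Polynomial.eval_C,
      Polynomial.eval_pow, Polynomial.eval_X]
    refine h2.unique (hasSum_sum_of_ne_finset_zero fun k hk => ?_)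
    rw [hp k (by simpa using hk), zero_mul]

lemma exists_polynomial_line (hF : PosDefOnC3 F)
    (hom : ∀ z (t : ℝ), 0 ≤ t → F (t * z) = t ^ j * F z) (z ρ : ℂ) :
    ∃ A : Polynomial ℂ, A.natDegree ≤ j ∧ ∀ t : ℝ, F (z + ρ * t) = A.eval (t : ℂ) := by
  refine exists_polynomial_of_forall_ray fun s => ?_
  obtain ⟨A, hA, h⟩ := hF.exists_polynomial_ray hom (z + ρ * s) ρ
  refine ⟨A, hA, fun t ht => ?_⟩
  rw [← h t ht]
  push_cast
  ring_nf

lemma exists_eq_sum_re_im (hF : PosDefOnC3 F)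
    (hom : ∀ z (t : ℝ), 0 ≤ t → F (t * z) = t ^ j * F z) :
    ∃ a : ℕ → ℂ, ∀ x y : ℝ, F (x + y * Complex.I) =
      ∑ k ∈ Finset.range (j + 1), a k * (x ^ (j - k) * y ^ k) := by
  obtain ⟨R, hR, h⟩ := hF.exists_polynomial_line hom 1 Complex.I
  refine ⟨R.coeff, fun x y => ?_⟩
  obtain ⟨A, -, hA⟩ := hF.exists_polynomial_line hom (y * Complex.I) 1
  have hAR : A = ∑ k ∈ Finset.range (j + 1),
      Polynomial.C (R.coeff k * y ^ k) * Polynomial.X ^ (j - k) := by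
    refine Polynomial.eq_of_infinite_eval_eq _ _ (Set.Infinite.mono ?_
      ((Set.Ioi_infinite (0 : ℝ)).image Complex.ofReal_injective.injOn))
    rintro _ ⟨t, ht, rfl⟩
    have ht : 0 < t := ht
    have htne : (t : ℂ) ≠ 0 := by simpa using ht.ne'
    have h1 : (y * Complex.I + 1 * t : ℂ) = t * (1 + Complex.I * ((y / t : ℝ) : ℂ)) := by
      push_cast
      field_simp
      ring
    rw [Set.mem_ofPred_eq, ← hA t, h1, hom _ _ ht.le, h,
      Polynomial.eval_eq_sum_range' (Nat.lt_succ_iff.2 hR), Polynomial.eval_finsetSum,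
      Finset.mul_sum]
    refine Finset.sum_congr rfl fun k hk => ?_
    have hk : k ≤ j := Nat.lt_succ_iff.1 (Finset.mem_range.1 hk)
    obtain ⟨l, rfl⟩ := Nat.exists_eq_add_of_le hk
    simp only [Polynomial.eval_mul, Polynomial.eval_C, Polynomial.eval_pow, Polynomial.eval_X,
      Nat.add_sub_cancel_left]
    push_cast
    rw [div_pow, pow_add]
    field_simp
  have h2 := hA x
  rw [one_mul, add_comm, hAR] at h2
  rw [h2, Polynomial.eval_finsetSum]
  refine Finset.sum_congr rfl fun k _ => ?_
  simp only [Polynomial.eval_mul, Polynomial.eval_C, Polynomial.eval_pow, Polynomial.eval_X]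
  ring

end PosDefOnC3

lemma exists_mul_add_mul_eq_sum_antidiagonal (α β : ℂ) {G : ℂ → ℂ} {n : ℕ} {b : ℕ × ℕ → ℂ}
    (hG : ∀ z, G z = ∑ kl ∈ Finset.HasAntidiagonal.antidiagonal n, b kl * z ^ kl.1 * conj z ^ kl.2) :
    ∃ b' : ℕ × ℕ → ℂ, ∀ z, (α * z + β * conj z) * G z =
      ∑ kl ∈ Finset.HasAntidiagonal.antidiagonal (n + 1), b' kl * z ^ kl.1 * conj z ^ kl.2 := by
  refine ⟨fun kl => α * (if kl.1 = 0 then 0 else b (kl.1 - 1, kl.2)) +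
    β * (if kl.2 = 0 then 0 else b (kl.1, kl.2 - 1)), fun z => ?_⟩
  simp only [add_mul, Finset.sum_add_distrib]
  rw [Finset.Nat.sum_antidiagonal_succ, Finset.Nat.sum_antidiagonal_succ']
  simp only [hG, Finset.mul_sum]
  simp
  congr 1 <;> refine Finset.sum_congr rfl fun kl _ => by ring

lemma exists_pow_re_mul_pow_im_eq_sum_antidiagonal (m n : ℕ) :
    ∃ b : ℕ × ℕ → ℂ, ∀ z : ℂ, (z.re : ℂ) ^ m * (z.im : ℂ) ^ n =
      ∑ kl ∈ Finset.HasAntidiagonal.antidiagonal (m + n), b kl * z ^ kl.1 * conj z ^ kl.2 := by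
  induction m with
  | zero =>
    induction n with
    | zero => exact ⟨1, by simp⟩
    | succ n ih =>
      obtain ⟨b, hb⟩ := ih
      obtain ⟨b', hb'⟩ := exists_mul_add_mul_eq_sum_antidiagonal
        (-Complex.I / 2) (Complex.I / 2) hb
      refine ⟨b', fun z => ?_⟩
      have him : (z.im : ℂ) = -Complex.I / 2 * z + Complex.I / 2 * conj z := by
        rw [Complex.im_eq_sub_conj, div_eq_iff (by simp)]
        linear_combination (z - conj z) * Complex.I_sq
      rw [← add_assoc, ← hb', pow_succ, ← him]
      ring
  | succ m ih =>
    obtain ⟨b, hb⟩ := ih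
    obtain ⟨b', hb'⟩ := exists_mul_add_mul_eq_sum_antidiagonal (1 / 2) (1 / 2) hb
    refine ⟨b', fun z => ?_⟩
    rw [add_right_comm, ← hb', pow_succ, Complex.re_eq_add_conj]
    ring

namespace PosDefOnC3

variable {F : ℂ → ℂ} {j : ℕ}

lemma exists_eq_sum_antidiagonal (hF : PosDefOnC3 F)
    (hom : ∀ z (t : ℝ), 0 ≤ t → F (t * z) = t ^ j * F z) :
    ∃ b : ℕ × ℕ → ℂ, ∀ z,
      F z = ∑ kl ∈ Finset.HasAntidiagonal.antidiagonal j, b kl * z ^ kl.1 * conj z ^ kl.2 := by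
  obtain ⟨a, ha⟩ := hF.exists_eq_sum_re_im hom
  choose b hb using exists_pow_re_mul_pow_im_eq_sum_antidiagonal
  refine ⟨fun kl => ∑ k ∈ Finset.range (j + 1), a k * b (j - k) k kl, fun z => ?_⟩
  simp only [Finset.sum_mul]
  rw [Finset.sum_comm]
  conv_lhs => rw [← Complex.re_add_im z, ha]
  refine Finset.sum_congr rfl fun k hk => ?_
  rw [hb, Nat.sub_add_cancel (Nat.lt_succ_iff.1 (Finset.mem_range.1 hk)), Finset.mul_sum]
  exact Finset.sum_congr rfl fun kl _ => by ring

end PosDefOnC3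

namespace PosDefOnC3

variable {F f : ℂ → ℂ} {j : ℕ}

lemma coeff_nonneg_of_eq_sum_antidiagonal (hF : PosDefOnC3 F) {b : ℕ × ℕ → ℂ}
    (hb : ∀ z, F z = ∑ kl ∈ Finset.HasAntidiagonal.antidiagonal j,
      b kl * z ^ kl.1 * conj z ^ kl.2) {kl : ℕ × ℕ}
    (hkl : kl ∈ Finset.HasAntidiagonal.antidiagonal j) : 0 ≤ b kl := by
  have hj : kl.1 + kl.2 = j := Finset.HasAntidiagonal.mem_antidiagonal.1 hkl
  set x : Fin (j + 1) → ℂ := fun p => 1 + (p : ℕ) * Complex.I with hx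
  have hx0 : ∀ p, conj (x p) ≠ 0 := fun p h => by
    have := congrArg Complex.re h
    simp [hx] at this
  have hv : Function.Injective fun p => x p / conj (x p) := by
    intro p q hpq
    have h := congrArg Complex.im ((div_eq_div_iff (hx0 p) (hx0 q)).1 hpq)
    simp [hx] at h
    have h' : ((p : ℕ) : ℝ) = (q : ℕ) := by linarith
    exact Fin.ext (by exact_mod_cast h')
  obtain ⟨c, hc⟩ := exists_dual_nodes _ hv ⟨kl.1, by omega⟩
  have hmom : ∀ mn ∈ Finset.HasAntidiagonal.antidiagonal j,
      ∑ p, c p / conj (x p) ^ j * (x p ^ mn.1 * conj (x p) ^ mn.2) = if mn = kl then 1 else 0 := by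
    intro mn hmn
    have hj' : mn.1 + mn.2 = j := Finset.HasAntidiagonal.mem_antidiagonal.1 hmn
    have h := hc ⟨mn.1, by omega⟩
    simp only [Fin.mk.injEq] at h
    have hiff : mn = kl ↔ mn.1 = kl.1 :=
      ⟨fun h => by rw [h], fun h => Prod.ext h (by omega)⟩
    simp only [hiff, ← h]
    refine Finset.sum_congr rfl fun p _ => ?_
    have := hx0 p
    rw [div_pow, ← hj', pow_add]
    field_simp
  refine (hF (j + 1) x 0 0 fun p => c p / conj (x p) ^ j).trans_eq ?_
  simp only [Pi.zero_apply, zero_mul, add_zero, hb, Finset.mul_sum]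
  simp_rw [Finset.sum_comm (t := Finset.HasAntidiagonal.antidiagonal j)]
  rw [← Finset.sum_ite_eq' (Finset.HasAntidiagonal.antidiagonal j) kl b |>.trans (if_pos hkl)]
  refine Finset.sum_congr rfl fun mn hmn => ?_
  have h2 : ∑ r, ∑ s, c r / conj (x r) ^ j * conj (c s / conj (x s) ^ j) *
      (b mn * (x r * conj (x s)) ^ mn.1 * conj (x r * conj (x s)) ^ mn.2) =
      b mn * ((∑ p, c p / conj (x p) ^ j * (x p ^ mn.1 * conj (x p) ^ mn.2)) *
        conj (∑ p, c p / conj (x p) ^ j * (x p ^ mn.1 * conj (x p) ^ mn.2))) := by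
    rw [map_sum, Finset.sum_mul_sum, Finset.mul_sum]
    refine Finset.sum_congr rfl fun r _ => ?_
    rw [Finset.mul_sum]
    refine Finset.sum_congr rfl fun s _ => ?_
    simp only [map_mul, map_pow, map_div₀, Complex.conj_conj, mul_pow]
    ring
  rw [h2, hmom mn hmn]
  split_ifs <;> simp

lemma form31 (hf : PosDefOnC3 f) : Form31 f := by
  obtain ⟨F, hF, hom, hsum⟩ := hf.exists_homogeneous
  choose b hb using fun n => (hF n).exists_eq_sum_antidiagonal (hom n)
  have hnn : ∀ kl : ℕ × ℕ, 0 ≤ b (kl.1 + kl.2) kl := fun kl =>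
    (hF _).coeff_nonneg_of_eq_sum_antidiagonal (hb _) (Finset.HasAntidiagonal.mem_antidiagonal.2 rfl)
  have hre : ∀ kl : ℕ × ℕ, ((b (kl.1 + kl.2) kl).re : ℂ) = b (kl.1 + kl.2) kl := fun kl =>
    (Complex.eq_re_of_ofReal_le (r := 0) (by simpa using hnn kl)).symm
  refine ⟨fun kl => (b (kl.1 + kl.2) kl).re, fun kl => (Complex.nonneg_iff.1 (hnn kl)).1,
    fun z => ?_⟩
  simp only [hre]
  have hinner : ∀ (w : ℂ) (n : ℕ), HasSum (fun kl : Finset.HasAntidiagonal.antidiagonal n =>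
      b (kl.1.1 + kl.1.2) kl.1 * w ^ kl.1.1 * conj w ^ kl.1.2) (F n w) := by
    intro w n
    rw [hb n w, ← Finset.sum_coe_sort]
    convert hasSum_fintype _ using 3 with kl
    rw [Finset.HasAntidiagonal.mem_antidiagonal.1 kl.2]
  rw [← Finset.HasAntidiagonal.sigmaAntidiagonalEquivProd.hasSum_iff]
  refine HasSum.sigma_of_hasSum (hsum z) (hinner z) ?_
  refine Summable.of_norm ?_
  have habs : ∀ kl : ℕ × ℕ, ‖b (kl.1 + kl.2) kl * z ^ kl.1 * conj z ^ kl.2‖ =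
      (b (kl.1 + kl.2) kl * (‖z‖ : ℂ) ^ kl.1 * conj (‖z‖ : ℂ) ^ kl.2).re := by
    intro kl
    rw [norm_mul, norm_mul, norm_pow, norm_pow, RCLike.norm_conj, Complex.conj_ofReal, ← hre kl,
      Complex.norm_real, Real.norm_eq_abs, abs_of_nonneg (Complex.nonneg_iff.1 (hnn kl)).1]
    norm_cast
  have hinner' : ∀ n : ℕ, HasSum (fun kl : Finset.HasAntidiagonal.antidiagonal n =>
      ‖b (kl.1.1 + kl.1.2) kl.1 * z ^ kl.1.1 * conj z ^ kl.1.2‖) (F n ‖z‖).re := by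
    intro n
    simp only [fun kl : Finset.HasAntidiagonal.antidiagonal n => habs kl.1]
    exact Complex.hasSum_re (hinner _ n)
  refine (summable_sigma_of_nonneg fun _ => norm_nonneg _).2 ⟨fun n => (hinner' n).summable, ?_⟩
  refine (Complex.hasSum_re (hsum ‖z‖)).summable.congr fun n => ?_
  exact (hinner' n).tsum_eq.symm

end PosDefOnC3

lemma exists_orthonormal_fin_of_le_rank {𝕜 H : Type*} [RCLike 𝕜] [NormedAddCommGroup H]
    [InnerProductSpace 𝕜 H] {n : ℕ} (h : (n : Cardinal) ≤ Module.rank 𝕜 H) :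
    ∃ e : Fin n → H, Orthonormal 𝕜 e := by
  obtain ⟨v, hv⟩ := Module.le_rank_iff.1 h
  exact ⟨_, InnerProductSpace.gramSchmidtNormed_orthonormal hv⟩

lemma posDefOnC3_of_posSemidef {H : Type*} [NormedAddCommGroup H] [InnerProductSpace ℂ H]
    (hdim : 3 ≤ Module.rank ℂ H) {f : ℂ → ℂ} (h : ∀ (n : ℕ) (z : Fin n → H),
      (Matrix.of fun r s : Fin n => f ⟪z s, z r⟫_ℂ).PosSemidef) : PosDefOnC3 f := by
  intro n x y w c
  obtain ⟨e, he⟩ := exists_orthonormal_fin_of_le_rank (𝕜 := ℂ) (H := H) (n := 3) (by simpa)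
  have hij := orthonormal_iff_ite.1 he
  refine ((Matrix.posSemidef_iff_dotProduct_mulVec.1
    (h n fun r => x r • e 0 + y r • e 1 + w r • e 2)).2 (star c)).trans_eq ?_
  simp only [dotProduct, Matrix.mulVec, star_star, Finset.mul_sum, Matrix.of_apply]
  refine Finset.sum_congr rfl fun r _ => Finset.sum_congr rfl fun s _ => ?_
  have : ⟪x s • e 0 + y s • e 1 + w s • e 2, x r • e 0 + y r • e 1 + w r • e 2⟫_ℂ =
      x r * conj (x s) + y r * conj (y s) + w r * conj (w s) := by
    simp only [inner_add_left, inner_add_right, inner_smul_left, inner_smul_right, hij]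
    simp
  rw [this]
  simp only [Pi.star_apply, RCLike.star_def]
  ring

lemma Matrix.PosSemidef.hadamard_pow {n : Type*} [Fintype n] [DecidableEq n] {A : Matrix n n ℂ}
    (hA : A.PosSemidef) (k : ℕ) : (Matrix.of fun r s => A r s ^ k).PosSemidef := by
  induction k with
  | zero =>
    convert Matrix.posSemidef_vecMulVec_self_star (1 : n → ℂ) using 1
    ext; simp [Matrix.vecMulVec]
  | succ k ih => exact ih.hadamard hA

lemma Form31.posSemidef {H : Type*} [NormedAddCommGroup H] [InnerProductSpace ℂ H] {f : ℂ → ℂ}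
    (hf : Form31 f) (n : ℕ) (z : Fin n → H) :
    (Matrix.of fun r s : Fin n => f ⟪z s, z r⟫_ℂ).PosSemidef := by
  obtain ⟨b, hb, hsum⟩ := hf
  have hconj : ∀ w, f (conj w) = conj (f w) := by
    intro w
    refine (hsum (conj w)).unique ?_
    simpa using Complex.hasSum_conj'.2 (hsum w)
  have hG : (Matrix.gram ℂ z).PosSemidef := Matrix.posSemidef_gram ℂ z
  have hterm : ∀ kl : ℕ × ℕ, (Matrix.of fun r s : Fin n =>
      (b kl : ℂ) * ⟪z s, z r⟫_ℂ ^ kl.1 * conj ⟪z s, z r⟫_ℂ ^ kl.2).PosSemidef := by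
    intro kl
    have h := ((hG.transpose.hadamard_pow kl.1).hadamard (hG.hadamard_pow kl.2)).smul
      (show (0 : ℂ) ≤ b kl by exact_mod_cast hb kl)
    refine (congrArg Matrix.PosSemidef ?_).mp h
    ext r s
    simp [Matrix.gram, mul_assoc]
  rw [Matrix.posSemidef_iff_dotProduct_mulVec]
  refine ⟨?_, fun c => ?_⟩
  · ext r s
    rw [Matrix.conjTranspose_apply, Matrix.of_apply, Matrix.of_apply, RCLike.star_def, ← hconj,
      inner_conj_symm]
  · have h : HasSum (fun kl : ℕ × ℕ => star c ⬝ᵥ (Matrix.of fun r s : Fin n =>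
        (b kl : ℂ) * ⟪z s, z r⟫_ℂ ^ kl.1 * conj ⟪z s, z r⟫_ℂ ^ kl.2).mulVec c)
        (star c ⬝ᵥ (Matrix.of fun r s : Fin n => f ⟪z s, z r⟫_ℂ).mulVec c) := by
      simp only [dotProduct, Matrix.mulVec, Matrix.of_apply]
      exact hasSum_sum fun r _ => (hasSum_sum fun s _ => (hsum _).mul_right _).mul_left _
    exact h.nonneg fun kl => (Matrix.posSemidef_iff_dotProduct_mulVec.1 (hterm kl)).2 c

end

/-- The paper's inner product `⟨x, y⟩` is linear in the first argument, i.e. it is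
`⟪y, x⟫_ℂ` in Mathlib's convention. -/
theorem stmt_0 {H : Type*} [NormedAddCommGroup H] [InnerProductSpace ℂ H]
    (hdim : 3 ≤ Module.rank ℂ H) (f : ℂ → ℂ) :
    (∀ (n : ℕ) (z : Fin n → H),
      (Matrix.of fun r s : Fin n => f ⟪z s, z r⟫_ℂ).PosSemidef) ↔ Form31 f :=
  ⟨fun h => (posDefOnC3_of_posSemidef hdim h).form31, fun h => h.posSemidef⟩
end

section
/- Fix m ∈ ℕ with m ≥ 1. If f ∈ F_m(ℂ), then f(conj(z)) = conj(f(z)) for every z ∈ ℂ; consequently Re f(conj(z)) = Re f(z) and Im f(conj(z)) = −Im f(z) for every z ∈ ℂ. -/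
open ComplexConjugate
open scoped ComplexOrder

/-- `FmC m f` : the class `F_m(ℂ)` of functions `f : ℂ → ℂ` such that for every `n` and every
`n × n` complex Hermitian positive semidefinite matrix `A` of rank at most `m`, the entrywise
image matrix `(f (A r s))` is Hermitian positive semidefinite. -/
def FmC (m : ℕ) (f : ℂ → ℂ) : Prop :=
  ∀ (n : ℕ) (A : Matrix (Fin n) (Fin n) ℂ),
    A.PosSemidef → A.rank ≤ m → (A.map f).PosSemidef

theorem stmt_4 (m : ℕ) (hm : 1 ≤ m) (f : ℂ → ℂ) (hf : FmC m f) :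
    ∀ z : ℂ, f (conj z) = conj (f z) ∧
      (f (conj z)).re = (f z).re ∧ (f (conj z)).im = -(f z).im := by
  intro z
  have h := (hf 2 (Matrix.vecMulVec ![z, 1] (star ![z, 1]))
    (Matrix.posSemidef_vecMulVec_self_star _)
    ((Matrix.rank_vecMulVec_le _ _).trans hm)).isHermitian.apply 1 0
  have key : f (conj z) = conj (f z) := by
    simpa [Matrix.vecMulVec_apply, -Matrix.cons_vecMulVec] using h.symm
  exact ⟨key, by simp [key], by simp [key]⟩
end

section
/- Fix m ∈ ℕ with m ≥ 1. If f ∈ F_m(ℂ), then: (a) the function u : ℂ → ℂ defined by u(z) = Re f(z) (viewed as a real-valued complex function) belongs to F_m(ℂ); (b) f maps ℝ into ℝ, i.e., f(t) is real for every real t; and (c) the restriction t ↦ Re f(t) (t ∈ ℝ) belongs to F_m(ℝ). -/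
open ComplexConjugate
open scoped ComplexOrder

/-- `FmR m f` : the class `F_m(ℝ)` of functions `f : ℝ → ℝ` such that for every `n` and every
`n × n` real symmetric positive semidefinite matrix `A` of rank at most `m`, the matrix
`(f (A r s))` is symmetric positive semidefinite. -/
def FmR (m : ℕ) (f : ℝ → ℝ) : Prop :=
  ∀ (n : ℕ) (A : Matrix (Fin n) (Fin n) ℝ),
    A.PosSemidef → A.rank ≤ m → (A.map f).PosSemidef

open scoped MatrixOrder in
/-- A real positive semidefinite matrix is positive semidefinite as a complex matrix. -/
theorem Matrix.PosSemidef.map_ofReal {n : Type*} [Fintype n] [DecidableEq n]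
    {A : Matrix n n ℝ} (hA : A.PosSemidef) :
    (A.map ((↑) : ℝ → ℂ)).PosSemidef := by
  obtain ⟨B, rfl⟩ := CStarAlgebra.nonneg_iff_eq_star_mul_self.mp hA.nonneg
  have h : (star B * B).map ((↑) : ℝ → ℂ) =
      (B.map ((↑) : ℝ → ℂ)).conjTranspose * B.map ((↑) : ℝ → ℂ) := by
    ext i j
    simp [Matrix.mul_apply, Matrix.star_apply]
  rw [h]
  exact Matrix.posSemidef_conjTranspose_mul_self _

/-- A matrix over a field factors through a space of dimension its rank. -/
theorem Matrix.exists_eq_mul_of_rank {K m n : Type*} [Field K] [Fintype m] [Fintype n]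
    (A : Matrix m n K) :
    ∃ (B : Matrix m (Fin A.rank) K) (C : Matrix (Fin A.rank) n K), A = B * C := by
  classical
  let b : Module.Basis (Fin A.rank) K (LinearMap.range A.mulVecLin) :=
    Module.finBasis K (LinearMap.range A.mulVecLin)
  have hmem (j : n) : A.col j ∈ LinearMap.range A.mulVecLin :=
    ⟨Pi.single j 1, by simp⟩
  refine ⟨.of fun i k => (b k : m → K) i, .of fun k j => b.repr ⟨A.col j, hmem j⟩ k, ?_⟩
  ext i j
  have h := congrFun (congrArg Subtype.val (b.sum_repr ⟨A.col j, hmem j⟩)) i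
  simp only [Submodule.coe_sum, Submodule.coe_smul, Finset.sum_apply, Pi.smul_apply, smul_eq_mul,
    Matrix.col_apply] at h
  simp only [Matrix.mul_apply, Matrix.of_apply, ← h, mul_comm]

/-- Extension of scalars does not increase the rank of a matrix. -/
theorem Matrix.rank_map_le {K L m n : Type*} [Field K] [Field L] [Fintype m] [Fintype n]
    (φ : K →+* L) (A : Matrix m n K) : (A.map φ).rank ≤ A.rank := by
  obtain ⟨B, C, h⟩ := A.exists_eq_mul_of_rank
  calc (A.map φ).rank = (B.map φ * C.map φ).rank := by rw [← Matrix.map_mul, ← h]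
    _ ≤ (B.map φ).rank := Matrix.rank_mul_le_left _ _
    _ ≤ A.rank := by simpa using (B.map φ).rank_le_card_width

/-- The entrywise real part of a complex positive semidefinite matrix is positive semidefinite
as a complex matrix. -/
theorem Matrix.PosSemidef.map_ofReal_re {n : Type*} {M : Matrix n n ℂ} (hM : M.PosSemidef) :
    (M.map fun z => (z.re : ℂ)).PosSemidef := by
  have h : (M.map fun z => (z.re : ℂ)) = (1 / 2 : ℝ) • (M + M.transpose) := by
    ext i j
    have hij : M j i = conj (M i j) := (hM.isHermitian.apply j i).symm
    simp only [Matrix.map_apply, Matrix.smul_apply, Matrix.add_apply, Matrix.transpose_apply, hij,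
      Complex.add_conj, Complex.real_smul]
    push_cast
    ring
  rw [h]
  exact (hM.add hM.transpose).smul (by norm_num)

/-- A real matrix that is positive semidefinite as a complex matrix is positive semidefinite. -/
theorem Matrix.PosSemidef.of_map_ofReal {n : Type*} [Fintype n] {A : Matrix n n ℝ}
    (hA : (A.map ((↑) : ℝ → ℂ)).PosSemidef) : A.PosSemidef := by
  refine .of_dotProduct_mulVec_nonneg ?_ fun x => ?_
  · ext i j
    have h := hA.isHermitian.apply i j
    simpa using h
  · have h := hA.dotProduct_mulVec_nonneg fun i => (x i : ℂ)
    have e : star (fun i => (x i : ℂ)) ⬝ᵥ (A.map ((↑) : ℝ → ℂ)).mulVec (fun i => (x i : ℂ)) =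
        ((star x ⬝ᵥ A.mulVec x : ℝ) : ℂ) := by
      simp [dotProduct, Matrix.mulVec]
    rw [e] at h
    exact_mod_cast h

theorem stmt_5 (m : ℕ) (hm : 1 ≤ m) (f : ℂ → ℂ) (hf : FmC m f) :
    FmC m (fun z => ((f z).re : ℂ)) ∧
    (∀ t : ℝ, (f (t : ℂ)).im = 0) ∧
    FmR m (fun t : ℝ => (f (t : ℂ)).re) := by
  refine ⟨fun n A hA hr => (hf n A hA hr).map_ofReal_re, fun t => ?_, fun n A hA hr => ?_⟩
  · have h := (hf 2 (Matrix.vecMulVec ![1, (t : ℂ)] (star ![1, (t : ℂ)]))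
      (Matrix.posSemidef_vecMulVec_self_star _)
      ((Matrix.rank_vecMulVec_le _ _).trans hm)).isHermitian.apply 0 1
    simp only [Matrix.map_apply, Matrix.vecMulVec_apply, Pi.star_apply, Matrix.cons_val_zero,
      Matrix.cons_val_one, star_one, mul_one, one_mul, Complex.star_def, Complex.conj_ofReal] at h
    exact Complex.conj_eq_iff_im.mp h
  · exact .of_map_ofReal (hf n _ hA.map_ofReal
      ((Matrix.rank_map_le Complex.ofRealHom A).trans hr)).map_ofReal_re
end

section
/- Fix m ∈ ℕ with m ≥ 2. If f ∈ F_m(ℝ), then there exist nonnegative reals c_k (k ∈ ℕ) such that the power series Σ_{k=0}^∞ c_k t^k converges for every t ∈ ℝ and f(t) = Σ_{k=0}^∞ c_k t^k for every t ∈ ℝ. -/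
open ComplexConjugate
open scoped ComplexOrder

open Set Filter Topology MeasureTheory
open scoped ContDiff

/-- The kernel `(x, y) ↦ f ⟪x, y⟫` on the plane is positive semidefinite. -/
def IsPlaneKernelPSD (f : ℝ → ℝ) : Prop :=
  ∀ (ι : Type) [Fintype ι] (u v w : ι → ℝ),
    0 ≤ ∑ i, ∑ j, w i * w j * f (u i * u j + v i * v j)

theorem FmR.isPlaneKernelPSD {m : ℕ} (hm : 2 ≤ m) {f : ℝ → ℝ} (hf : FmR m f) :
    IsPlaneKernelPSD f := by
  intro ι _ u v w
  let e := Fintype.equivFin ι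
  let B : Matrix (Fin (Fintype.card ι)) (Fin 2) ℝ :=
    Matrix.of fun i k => ![u (e.symm i), v (e.symm i)] k
  have hA := hf _ (B * B.conjTranspose) (Matrix.posSemidef_self_mul_conjTranspose B)
    (((Matrix.rank_mul_le_left _ _).trans (Matrix.rank_le_width B)).trans hm)
  have h := hA.dotProduct_mulVec_nonneg (fun i => w (e.symm i))
  refine h.trans_eq ?_
  symm
  simp only [dotProduct, Matrix.mulVec, Finset.mul_sum]
  rw [← e.symm.sum_comp]
  refine Finset.sum_congr rfl fun i _ => ?_
  rw [← e.symm.sum_comp]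
  refine Finset.sum_congr rfl fun j _ => ?_
  simp [B, Matrix.mul_apply, Fin.sum_univ_two]
  ring

namespace IsPlaneKernelPSD

variable {f : ℝ → ℝ}

theorem add_mul_comp_neg (hf : IsPlaneKernelPSD f) {ε : ℝ} (hε : ε * ε = 1) :
    IsPlaneKernelPSD fun t => f t + ε * f (-t) := by
  intro ι _ u v w
  have h := hf (ι ⊕ ι) (Sum.elim u (-u)) (Sum.elim v (-v)) (Sum.elim w (ε • w))
  simp only [Fintype.sum_sum_type, Sum.elim_inl, Sum.elim_inr, Pi.neg_apply, Pi.smul_apply,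
    smul_eq_mul, ← Finset.sum_add_distrib] at h
  have h2 : 0 ≤ 2 * ∑ i, ∑ j, w i * w j *
      (f (u i * u j + v i * v j) + ε * f (-(u i * u j + v i * v j))) := by
    convert h using 1
    rw [Finset.mul_sum]
    refine Finset.sum_congr rfl fun i _ => ?_
    rw [Finset.mul_sum]
    refine Finset.sum_congr rfl fun j _ => ?_
    have e1 : u i * -u j + v i * -v j = -(u i * u j + v i * v j) := by ring
    have e2 : -u i * u j + -v i * v j = -(u i * u j + v i * v j) := by ring
    have e3 : -u i * -u j + -v i * -v j = u i * u j + v i * v j := by ring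
    rw [e1, e2, e3]
    linear_combination (- w i * w j * f (u i * u j + v i * v j)) * hε
  linarith

theorem monotoneOn (hf : IsPlaneKernelPSD f) : MonotoneOn f (Ici 0) := by
  intro s hs t ht hst
  have hs' : (0 : ℝ) ≤ s := hs
  have ht' : (0 : ℝ) ≤ t := ht
  have h := hf (Fin 2) ![√((t + s) / 2), √((t + s) / 2)] ![√((t - s) / 2), -√((t - s) / 2)]
    ![1, -1]
  have h1 := Real.mul_self_sqrt (show 0 ≤ (t + s) / 2 by linarith)
  have h2 := Real.mul_self_sqrt (show 0 ≤ (t - s) / 2 by linarith)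
  have e1 : (t + s) / 2 + (t - s) / 2 = t := by ring
  have e2 : (t + s) / 2 + -((t - s) / 2) = s := by ring
  simp only [Fin.sum_univ_two, Matrix.cons_val_zero, Matrix.cons_val_one, mul_neg, neg_mul, neg_neg,
    h1, h2, e1, e2] at h
  linarith

theorem abs_cross_sum_le (hf : IsPlaneKernelPSD f) {ι : Type} [Fintype ι]
    (w u v u' v' : ι → ℝ) :
    2 * |∑ i, ∑ j, w i * w j * f (u i * u' j + v i * v' j)| ≤
      (∑ i, ∑ j, w i * w j * f (u i * u j + v i * v j)) +
        ∑ i, ∑ j, w i * w j * f (u' i * u' j + v' i * v' j) := by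
  have key : ∀ ε : ℝ, ε * ε = 1 →
      0 ≤ (∑ i, ∑ j, w i * w j * f (u i * u j + v i * v j)) +
        (∑ i, ∑ j, w i * w j * f (u' i * u' j + v' i * v' j)) +
        2 * ε * ∑ i, ∑ j, w i * w j * f (u i * u' j + v i * v' j) := by
    intro ε hε
    have h := hf (ι ⊕ ι) (Sum.elim u u') (Sum.elim v v') (Sum.elim w (ε • w))
    simp only [Fintype.sum_sum_type, Sum.elim_inl, Sum.elim_inr, Pi.smul_apply,
      smul_eq_mul, Finset.sum_add_distrib] at h
    have hsymm : ∑ i, ∑ j, ε * w i * w j * f (u' i * u j + v' i * v j) =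
        ε * ∑ i, ∑ j, w i * w j * f (u i * u' j + v i * v' j) := by
      rw [Finset.sum_comm, Finset.mul_sum]
      refine Finset.sum_congr rfl fun i _ => ?_
      rw [Finset.mul_sum]
      refine Finset.sum_congr rfl fun j _ => ?_
      rw [mul_comm (u' j), mul_comm (v' j)]
      ring
    have hcross : ∑ i, ∑ j, w i * (ε * w j) * f (u i * u' j + v i * v' j) =
        ε * ∑ i, ∑ j, w i * w j * f (u i * u' j + v i * v' j) := by
      rw [Finset.mul_sum]
      refine Finset.sum_congr rfl fun i _ => ?_
      rw [Finset.mul_sum]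
      exact Finset.sum_congr rfl fun j _ => by ring
    have hdiag : ∑ i, ∑ j, ε * w i * (ε * w j) * f (u' i * u' j + v' i * v' j) =
        ∑ i, ∑ j, w i * w j * f (u' i * u' j + v' i * v' j) := by
      refine Finset.sum_congr rfl fun i _ => Finset.sum_congr rfl fun j _ => ?_
      linear_combination (w i * w j * f (u' i * u' j + v' i * v' j)) * hε
    rw [hsymm, hcross, hdiag] at h
    linarith
  have h1 := key 1 (by norm_num)
  have h2 := key (-1) (by norm_num)
  rcases abs_cases (∑ i, ∑ j, w i * w j * f (u i * u' j + v i * v' j)) with ⟨h, _⟩ | ⟨h, _⟩ <;>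
    rw [h] <;> linarith

end IsPlaneKernelPSD

/-- The coefficients of the `p`-th forward difference. -/
def diffCoeff (p : ℕ) (i : Fin (p + 1)) : ℝ :=
  (-1) ^ (p - (i : ℕ)) * p.choose i

theorem sum_diffCoeff_mul (p : ℕ) (g : ℝ → ℝ) :
    ∑ i, diffCoeff p i * g i = (fwdDiff 1)^[p] g 0 := by
  rw [fwdDiff_iter_eq_sum_shift, Finset.sum_range]
  simp [diffCoeff]

theorem sum_diffCoeff_mul_pow_self (p : ℕ) :
    ∑ i, diffCoeff p i * ((i : ℕ) : ℝ) ^ p = p.factorial := by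
  rw [sum_diffCoeff_mul p (fun r => r ^ p), fwdDiff_iter_eq_factorial]
  simp

theorem sum_diffCoeff_mul_affine_pow {p l : ℕ} (h : l < p) (α β : ℝ) :
    ∑ i, diffCoeff p i * (α * ((i : ℕ) : ℝ) + β) ^ l = 0 := by
  simp only [add_pow, mul_pow, Finset.mul_sum]
  rw [Finset.sum_comm]
  refine Finset.sum_eq_zero fun k hk => ?_
  have hk' : k < p := by
    have := Finset.mem_range.1 hk
    omega
  have h0 : ∑ i, diffCoeff p i * ((i : ℕ) : ℝ) ^ k = 0 := by
    rw [sum_diffCoeff_mul p (fun r => r ^ k), fwdDiff_iter_pow_eq_zero_of_lt hk']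
    simp
  calc _ = ∑ i, (α ^ k * β ^ (l - k) * l.choose k) * (diffCoeff p i * ((i : ℕ) : ℝ) ^ k) :=
        Finset.sum_congr rfl fun i _ => by ring
    _ = 0 := by rw [← Finset.mul_sum, h0, mul_zero]

/-- Taylor expansion of a weighted sum of dilates of a smooth function whose weights annihilate
the powers of exponent less than `p`. -/
theorem exists_abs_sum_comp_sub_le {ι : Type*} [Fintype ι] {F : ℝ → ℝ} (hF : ContDiff ℝ ∞ F)
    (w b : ι → ℝ) (c : ℝ) {p : ℕ} (hw : ∀ l < p, ∑ k, w k * b k ^ l = 0) :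
    ∃ C, ∀ u ∈ Icc (0 : ℝ) 1, |∑ k, w k * F (c + b k * u) -
      iteratedDeriv p F c / p.factorial * (∑ k, w k * b k ^ p) * u ^ p| ≤ C * u ^ (p + 1) := by
  have hφ : ContDiff ℝ ∞ fun u => ∑ k, w k * F (c + b k * u) :=
    ContDiff.sum fun k _ => contDiff_const.mul
      (hF.comp (contDiff_const.add (contDiff_const.mul contDiff_id)))
  obtain ⟨C, hC⟩ := exists_taylor_mean_remainder_bound (n := p) zero_le_one
    (hφ.of_le (by exact_mod_cast le_top)).contDiffOn
  have hderiv : ∀ l, iteratedDeriv l (fun u => ∑ k, w k * F (c + b k * u)) 0 =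
      iteratedDeriv l F c * ∑ k, w k * b k ^ l := by
    intro l
    have hFl : ContDiff ℝ l fun t => F (c + t) :=
      (hF.comp (contDiff_const.add contDiff_id)).of_le (by exact_mod_cast le_top)
    have hk : ∀ k, ContDiff ℝ l fun u => F (c + b k * u) := fun k =>
      hFl.comp (contDiff_const.mul contDiff_id)
    rw [iteratedDeriv_fun_sum (fun k _ => (contDiff_const.mul (hk k)).contDiffAt), Finset.mul_sum]
    refine Finset.sum_congr rfl fun k _ => ?_
    rw [iteratedDeriv_const_mul_field, iteratedDeriv_comp_const_mul hFl,
      iteratedDeriv_comp_const_add]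
    simp only [mul_zero, add_zero]
    ring
  refine ⟨C, fun u hu => ?_⟩
  have h := hC u hu
  have htaylor : taylorWithinEval (fun u => ∑ k, w k * F (c + b k * u)) p (Icc 0 1) 0 u =
      iteratedDeriv p F c / p.factorial * (∑ k, w k * b k ^ p) * u ^ p := by
    have hd : ∀ l, iteratedDerivWithin l (fun u => ∑ k, w k * F (c + b k * u)) (Icc 0 1) 0 =
        iteratedDeriv l F c * ∑ k, w k * b k ^ l := fun l => by
      rw [iteratedDerivWithin_eq_iteratedDeriv (uniqueDiffOn_Icc zero_lt_one)
        (hφ.of_le (by exact_mod_cast le_top)).contDiffAt (by simp), hderiv]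
    rw [taylor_within_apply, Finset.sum_range_succ, Finset.sum_eq_zero, hd, smul_eq_mul]
    · simp only [sub_zero, zero_add]
      ring
    · intro l hl
      rw [hd, hw l (Finset.mem_range.1 hl), mul_zero, smul_zero]
  rw [htaylor, Real.norm_eq_abs, sub_zero] at h
  exact h

theorem exists_lagrange_remainder {g : ℝ → ℝ} (hg : ContDiff ℝ ∞ g) (n : ℕ) (a : ℝ) {y : ℝ}
    (hy : 0 < y) :
    ∃ ξ ∈ Ioo a (a + y), g (a + y) =
      ∑ k ∈ Finset.range (n + 1), iteratedDeriv k g a / k.factorial * y ^ k +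
        iteratedDeriv (n + 1) g ξ / (n + 1).factorial * y ^ (n + 1) := by
  have hlt : a < a + y := by linarith
  obtain ⟨ξ, hξ, h⟩ := taylor_mean_remainder_lagrange_iteratedDeriv (n := n) hlt.ne
    (hg.of_le (by exact_mod_cast le_top)).contDiffOn
  rw [uIoo_of_lt hlt] at hξ
  refine ⟨ξ, hξ, ?_⟩
  rw [uIcc_of_le hlt.le, taylor_within_apply, add_sub_cancel_left, sub_eq_iff_eq_add'] at h
  rw [h]
  congr 1
  · refine Finset.sum_congr rfl fun k _ => ?_
    rw [iteratedDerivWithin_eq_iteratedDeriv (uniqueDiffOn_Icc hlt)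
      (hg.of_le (by exact_mod_cast le_top)).contDiffAt (left_mem_Icc.2 hlt.le), smul_eq_mul]
    ring
  · ring

theorem sum_taylor_le {g : ℝ → ℝ} (hg : ContDiff ℝ ∞ g)
    (hn : ∀ n, ∀ a, 0 ≤ a → 0 ≤ iteratedDeriv n g a) (n : ℕ) {a y : ℝ} (ha : 0 ≤ a) (hy : 0 < y) :
    ∑ k ∈ Finset.range (n + 1), iteratedDeriv k g a / k.factorial * y ^ k ≤ g (a + y) := by
  obtain ⟨ξ, hξ, h⟩ := exists_lagrange_remainder hg n a hy
  rw [h]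
  have := hn (n + 1) ξ (ha.trans hξ.1.le)
  have : 0 ≤ iteratedDeriv (n + 1) g ξ / (n + 1).factorial * y ^ (n + 1) := by positivity
  linarith

theorem le_sum_taylor_add {g : ℝ → ℝ} (hg : ContDiff ℝ ∞ g)
    (hn : ∀ n, ∀ a, 0 ≤ a → 0 ≤ iteratedDeriv n g a)
    (hmono : MonotoneOn g (Ici 0)) (n : ℕ) {y : ℝ} (hy : 0 < y) :
    g y ≤ ∑ k ∈ Finset.range (n + 1), iteratedDeriv k g 0 / k.factorial * y ^ k +
      g (3 * y) / 2 ^ (n + 1) := by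
  obtain ⟨ξ, hξ, h⟩ := exists_lagrange_remainder hg n 0 hy
  rw [zero_add] at h hξ
  have h1 := sum_taylor_le hg hn (n + 1) hξ.1.le (show 0 < 2 * y by linarith)
  have h2 : g (ξ + 2 * y) ≤ g (3 * y) :=
    hmono (mem_Ici.2 (by linarith [hξ.1])) (mem_Ici.2 (by linarith)) (by linarith [hξ.2])
  have h3 : iteratedDeriv (n + 1) g ξ / (n + 1).factorial * (2 * y) ^ (n + 1) ≤
      ∑ k ∈ Finset.range (n + 1 + 1), iteratedDeriv k g ξ / k.factorial * (2 * y) ^ k :=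
    Finset.single_le_sum (f := fun k => iteratedDeriv k g ξ / k.factorial * (2 * y) ^ k)
      (fun k _ => by have := hn k ξ hξ.1.le; positivity) (Finset.self_mem_range_succ (n + 1))
  have h4 : iteratedDeriv (n + 1) g ξ / (n + 1).factorial * y ^ (n + 1) ≤
      g (3 * y) / 2 ^ (n + 1) := by
    rw [le_div_iff₀ (by positivity)]
    rw [mul_pow] at h3
    linarith
  linarith

theorem sum_prod_mul_mul_pow {ι : Type*} [Fintype ι] (w a b : ι → ℝ) (l : ℕ) :
    ∑ k : ι × ι, w k.1 * w k.2 * (a k.1 * b k.2) ^ l =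
      (∑ i, w i * a i ^ l) * ∑ i, w i * b i ^ l := by
  rw [Fintype.sum_prod_type, Finset.sum_mul_sum]
  exact Finset.sum_congr rfl fun i _ => Finset.sum_congr rfl fun j _ => by ring

theorem iteratedDeriv_nonneg_of_kernel {g : ℝ → ℝ} (hg : ContDiff ℝ ∞ g) {a : ℝ}
    (h : ∀ (n : ℕ) (w s : Fin n → ℝ), (∀ i, 0 ≤ s i) →
      0 ≤ ∑ i, ∑ j, w i * w j * g (a + s i * s j)) (p : ℕ) :
    0 ≤ iteratedDeriv p g a := by
  obtain ⟨C, hC⟩ := exists_abs_sum_comp_sub_le hg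
    (fun k : Fin (p + 1) × Fin (p + 1) => diffCoeff p k.1 * diffCoeff p k.2)
    (fun k => ((k.1 : ℕ) : ℝ) * ((k.2 : ℕ) : ℝ)) a (p := p) (fun l hl => by
      have h0 := sum_diffCoeff_mul_affine_pow hl 1 0
      simp only [one_mul, add_zero] at h0
      rw [sum_prod_mul_mul_pow _ (fun i : Fin (p + 1) => ((i : ℕ) : ℝ)) fun i => ((i : ℕ) : ℝ), h0,
        zero_mul])
  rw [sum_prod_mul_mul_pow _ (fun i : Fin (p + 1) => ((i : ℕ) : ℝ)) fun i => ((i : ℕ) : ℝ),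
    sum_diffCoeff_mul_pow_self] at hC
  have hfac : (0 : ℝ) < p.factorial := by positivity
  have hlim : Tendsto (fun u : ℝ => iteratedDeriv p g a * p.factorial + C * u) (𝓝[>] 0)
      (𝓝 (iteratedDeriv p g a * p.factorial + C * 0)) :=
    ((continuous_const.add (continuous_const.mul continuous_id)).tendsto 0).mono_left
      nhdsWithin_le_nhds
  have hge : 0 ≤ iteratedDeriv p g a * p.factorial + C * 0 := by
    refine ge_of_tendsto hlim ?_
    filter_upwards [Ioo_mem_nhdsGT zero_lt_one] with u hu
    have h1 := (abs_le.1 (hC u ⟨hu.1.le, hu.2.le⟩)).2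
    have h2 := h (p + 1) (diffCoeff p) (fun i => ((i : ℕ) : ℝ) * √u) (fun i => by positivity)
    have h3 : 0 ≤ ∑ k : Fin (p + 1) × Fin (p + 1), diffCoeff p k.1 * diffCoeff p k.2 *
        g (a + ((k.1 : ℕ) : ℝ) * ((k.2 : ℕ) : ℝ) * u) := by
      rw [Fintype.sum_prod_type]
      refine h2.trans_eq (Finset.sum_congr rfl fun i _ => Finset.sum_congr rfl fun j _ => ?_)
      congr 3
      linear_combination (((i : ℕ) : ℝ) * ((j : ℕ) : ℝ)) * Real.mul_self_sqrt hu.1.le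
    have h4 : 0 ≤ u ^ p * (iteratedDeriv p g a * p.factorial + C * u) := by
      have : iteratedDeriv p g a / p.factorial * (p.factorial * p.factorial) * u ^ p =
          iteratedDeriv p g a * p.factorial * u ^ p := by field_simp
      rw [this] at h1
      linear_combination h1 + h3
    exact nonneg_of_mul_nonneg_right h4 (pow_pos hu.1 p)
  rw [mul_zero, add_zero] at hge
  exact nonneg_of_mul_nonneg_left hge hfac

theorem IsPlaneKernelPSD.exists_smooth_approx {f : ℝ → ℝ} (hf : IsPlaneKernelPSD f) {δ : ℝ}
    (hδ : 0 < δ) :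
    ∃ g : ℝ → ℝ, ContDiff ℝ ∞ g ∧ (∀ n, ∀ a, 0 ≤ a → 0 ≤ iteratedDeriv n g a) ∧
      ∀ x, 0 ≤ x → f x ≤ g x ∧ g x ≤ f (x + 3 * δ) := by
  let φ : ContDiffBump (0 : ℝ) := ⟨δ / 2, δ, by linarith, by linarith⟩
  let ψ : ℝ → ℝ := φ.normed volume
  let h : ℝ → ℝ := fun x => f (max x 0)
  have hmono : Monotone h := fun x y hxy =>
    hf.monotoneOn (mem_Ici.2 (le_max_right _ _)) (mem_Ici.2 (le_max_right _ _)) (max_le_max_right 0 hxy)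
  have hsupp : ∀ y, ψ y ≠ 0 → |y| < δ := fun y hy => by
    have : y ∈ Function.support ψ := hy
    rw [φ.support_normed_eq, mem_ball_zero_iff] at this
    exact this
  have hint : ∀ x, Integrable fun y => ψ y * h (x - y) :=
    φ.hasCompactSupport_normed.convolutionExists_left (ContinuousLinearMap.mul ℝ ℝ)
      φ.continuous_normed hmono.locallyIntegrable
  let g : ℝ → ℝ := fun x => ∫ y, ψ y * h (x + 2 * δ - y)
  have hg : ContDiff ℝ ∞ g :=
    (φ.hasCompactSupport_normed.contDiff_convolution_left (ContinuousLinearMap.mul ℝ ℝ)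
      φ.contDiff_normed hmono.locallyIntegrable).comp (contDiff_id.add contDiff_const)
  have hone : ∀ r : ℝ, ∫ y, ψ y * r = r := fun r => by
    rw [integral_mul_const, φ.integral_normed, one_mul]
  have hle : ∀ y {r s : ℝ}, (|y| < δ → r ≤ s) → ψ y * r ≤ ψ y * s := fun y r s hrs => by
    by_cases hy : ψ y = 0
    · simp [hy]
    · exact mul_le_mul_of_nonneg_left (hrs (hsupp y hy)) (φ.nonneg_normed y)
  refine ⟨g, hg, fun n a ha => ?_, fun x hx => ⟨?_, ?_⟩⟩
  · refine iteratedDeriv_nonneg_of_kernel hg (fun n w s hs => ?_) n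
    have hsum : ∑ i, ∑ j, w i * w j * g (a + s i * s j) =
        ∫ y, ψ y * ∑ i, ∑ j, w i * w j * h (a + s i * s j + 2 * δ - y) := by
      simp only [Finset.mul_sum]
      have hintij : ∀ i j,
          Integrable (fun y => ψ y * (w i * w j * h (a + s i * s j + 2 * δ - y))) := fun i j =>
        ((hint _).const_mul (w i * w j)).congr (ae_of_all _ fun y => by ring)
      rw [integral_finsetSum _ fun i _ => integrable_finsetSum _ fun j _ => hintij i j]
      refine Finset.sum_congr rfl fun i _ => ?_
      rw [integral_finsetSum _ fun j _ => hintij i j]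
      refine Finset.sum_congr rfl fun j _ => ?_
      rw [← integral_const_mul]
      exact integral_congr_ae (ae_of_all _ fun y => by ring)
    rw [hsum]
    refine integral_nonneg fun y => ?_
    refine (mul_zero (ψ y)).ge.trans (hle y fun hy => ?_)
    have hpos : 0 ≤ a + 2 * δ - y := by linarith [(abs_lt.1 hy).2]
    refine (hf (Fin n) (fun _ => √(a + 2 * δ - y)) s w).trans_eq
      (Finset.sum_congr rfl fun i _ => Finset.sum_congr rfl fun j _ => ?_)
    have := mul_nonneg (hs i) (hs j)
    simp only [h]
    rw [Real.mul_self_sqrt hpos, max_eq_left (by linarith)]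
    congr 2
    ring
  · rw [← hone (f x)]
    refine integral_mono (φ.integrable_normed.mul_const _) (hint _) fun y => hle y fun hy => ?_
    have := abs_lt.1 hy
    exact hf.monotoneOn hx (mem_Ici.2 (le_max_right _ _)) (le_max_of_le_left (by linarith))
  · rw [← hone (f (x + 3 * δ))]
    refine integral_mono (hint _) (φ.integrable_normed.mul_const _) fun y => hle y fun hy => ?_
    have := abs_lt.1 hy
    exact hf.monotoneOn (mem_Ici.2 (le_max_right _ _)) (mem_Ici.2 (by linarith))
      (max_le (by linarith) (by linarith))

theorem analyticOnNhd_tsum_mul_pow {c : ℕ → ℝ} (hs : ∀ t : ℝ, Summable fun k => c k * t ^ k) :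
    AnalyticOnNhd ℝ (fun t => ∑' k, c k * t ^ k) univ := by
  let q := FormalMultilinearSeries.ofScalars ℝ c
  have hr : q.radius = ⊤ := by
    refine ENNReal.eq_top_of_forall_nnreal_le fun r => q.le_radius_of_summable_norm ?_
    refine (hs r).norm.congr fun k => ?_
    simp [q]
  have h := q.analyticOnNhd
  rw [hr, Metric.eball_top] at h
  convert h using 1
  funext t
  simp [q, FormalMultilinearSeries.sum, mul_comm]

/-- Montel-type compactness for power series with nonnegative coefficients that are bounded
uniformly at every point of the positive half-line. -/
theorem exists_subseq_tendsto_tsum_mul_pow {c : ℕ → ℕ → ℝ} {B : ℝ → ℝ} (hc : ∀ N k, 0 ≤ c N k)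
    (hB : ∀ N k, ∀ x, 0 < x → c N k * x ^ k ≤ B x) :
    ∃ (d : ℕ → ℝ) (φ : ℕ → ℕ), StrictMono φ ∧ (∀ k, 0 ≤ d k) ∧
      (∀ t : ℝ, Summable fun k => d k * t ^ k) ∧
      ∀ x, 0 < x → Tendsto (fun N => ∑' k, c (φ N) k * x ^ k) atTop (𝓝 (∑' k, d k * x ^ k)) := by
  obtain ⟨d, hd, φ, hφ, hlim⟩ := (isCompact_univ_pi fun _ : ℕ =>
    (isCompact_Icc : IsCompact (Icc (0 : ℝ) (B 1)))).tendsto_subseq (x := c) (fun N k _ =>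
      ⟨hc N k, by simpa using hB N k 1 one_pos⟩)
  rw [tendsto_pi_nhds] at hlim
  have hd0 : ∀ k, 0 ≤ d k := fun k => (hd k (mem_univ k)).1
  have hscale : ∀ a x : ℝ, ∀ k, a * (2 * x) ^ k ≤ B (2 * x) → a * x ^ k ≤ B (2 * x) * (1 / 2) ^ k :=
    fun a x k h => by
      calc a * x ^ k = a * (2 * x) ^ k * (1 / 2) ^ k := by rw [mul_assoc, ← mul_pow]; congr 2; ring
        _ ≤ _ := by gcongr
  have hgeom : ∀ x : ℝ, Summable fun k : ℕ => B x * (1 / 2 : ℝ) ^ k := fun x =>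
    summable_geometric_two.mul_left _
  have hdB : ∀ k, ∀ x : ℝ, 0 < x → d k * x ^ k ≤ B x := fun k x hx =>
    le_of_tendsto' ((hlim k).mul_const _) fun N => hB _ k x hx
  refine ⟨d, φ, hφ, hd0, fun t => ?_, fun x hx => ?_⟩
  · have hx : 0 < |t| + 1 := by positivity
    refine Summable.of_norm_bounded (hgeom (2 * (|t| + 1))) fun k => ?_
    rw [Real.norm_eq_abs, abs_mul, abs_pow, abs_of_nonneg (hd0 k)]
    refine le_trans ?_ (hscale _ _ _ (hdB k _ (by positivity)))
    have := hd0 k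
    gcongr
    linarith
  · refine tendsto_tsum_of_dominated_convergence (hgeom (2 * x))
      (fun k => (hlim k).mul_const _) (Eventually.of_forall fun N k => ?_)
    rw [Real.norm_of_nonneg (mul_nonneg (hc _ _) (by positivity))]
    exact hscale _ _ _ (hB _ _ _ (by positivity))

theorem IsPlaneKernelPSD.exists_eq_tsum_of_pos {f : ℝ → ℝ} (hf : IsPlaneKernelPSD f) :
    ∃ c : ℕ → ℝ, (∀ k, 0 ≤ c k) ∧ (∀ t : ℝ, Summable fun k => c k * t ^ k) ∧
      ∀ t, 0 < t → f t = ∑' k, c k * t ^ k := by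
  have hδ : ∀ N : ℕ, (0 : ℝ) < 1 / ((N : ℝ) + 1) := fun N => Nat.one_div_pos_of_nat
  have hδ1 : ∀ N : ℕ, 1 / ((N : ℝ) + 1) ≤ 1 := fun N => by
    rw [div_le_one (by positivity)]
    linarith [N.cast_nonneg (α := ℝ)]
  choose g hg hn hle using fun N : ℕ => hf.exists_smooth_approx (hδ N)
  let c : ℕ → ℕ → ℝ := fun N k =>
    if k ∈ Finset.range (N + 1) then iteratedDeriv k (g N) 0 / k.factorial else 0
  have hc : ∀ N k, 0 ≤ c N k := fun N k => by
    have := hn N k 0 le_rfl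
    simp only [c]
    split_ifs <;> positivity
  have hsum : ∀ N (x : ℝ), HasSum (fun k => c N k * x ^ k)
      (∑ k ∈ Finset.range (N + 1), iteratedDeriv k (g N) 0 / k.factorial * x ^ k) := fun N x => by
    rw [Finset.sum_congr rfl fun k hk =>
      (show iteratedDeriv k (g N) 0 / k.factorial * x ^ k = c N k * x ^ k by simp only [c, if_pos hk])]
    exact hasSum_sum_of_ne_finset_zero fun k hk => by simp only [c, if_neg hk, zero_mul]
  have hupper : ∀ N (x : ℝ), 0 < x → ∑' k, c N k * x ^ k ≤ f (x + 3 * (1 / ((N : ℝ) + 1))) :=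
    fun N x hx => by
      rw [(hsum N x).tsum_eq]
      have := sum_taylor_le (hg N) (hn N) N le_rfl hx
      rw [zero_add] at this
      exact this.trans (hle N x hx.le).2
  have hmono3 : ∀ (N : ℕ) (x : ℝ), 0 < x → f (x + 3 * (1 / ((N : ℝ) + 1))) ≤ f (x + 3) :=
    fun N x hx => hf.monotoneOn (mem_Ici.2 (by have := hδ N; positivity))
      (mem_Ici.2 (by positivity)) (by linarith [hδ1 N])
  obtain ⟨d, φ, hφ, hd, hds, hlim⟩ := exists_subseq_tendsto_tsum_mul_pow (B := fun x => f (x + 3)) hc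
    fun N k x hx => ((hsum N x).summable.le_tsum k fun j _ =>
      mul_nonneg (hc N j) (by positivity)).trans ((hupper N x hx).trans (hmono3 N x hx))
  have hlower : ∀ N (x : ℝ), 0 < x →
      f x ≤ ∑' k, c N k * x ^ k + f (3 * x + 3) / 2 ^ (N + 1) := fun N x hx => by
    have hmono : MonotoneOn (g N) (Ici 0) := by
      refine monotoneOn_of_deriv_nonneg (convex_Ici 0) (hg N).continuous.continuousOn
        ((hg N).differentiable (by simp)).differentiableOn fun y hy => ?_
      rw [interior_Ici] at hy
      simpa using hn N 1 y (le_of_lt hy)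
    rw [(hsum N x).tsum_eq]
    refine (hle N x hx.le).1.trans ((le_sum_taylor_add (hg N) (hn N) hmono N hx).trans ?_)
    gcongr
    exact (hle N (3 * x) (by positivity)).2.trans (hmono3 N (3 * x) (by positivity))
  have hfd : ∀ x, 0 < x → f x ≤ ∑' k, d k * x ^ k := fun x hx => by
    have h2 : Tendsto (fun N : ℕ => f (3 * x + 3) / (2 : ℝ) ^ (φ N + 1)) atTop (𝓝 0) :=
      tendsto_const_nhds.div_atTop ((tendsto_pow_atTop_atTop_of_one_lt one_lt_two).comp
        ((tendsto_add_atTop_nat 1).comp hφ.tendsto_atTop))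
    have h3 := (hlim x hx).add h2
    rw [add_zero] at h3
    exact ge_of_tendsto' h3 fun N => hlower (φ N) x hx
  have hdf : ∀ x y, 0 < x → x < y → ∑' k, d k * x ^ k ≤ f y := fun x y hx hxy => by
    have h2 : Tendsto (fun N : ℕ => x + 3 * (1 / (((φ N : ℕ) : ℝ) + 1))) atTop (𝓝 (x + 3 * 0)) :=
      tendsto_const_nhds.add ((tendsto_one_div_add_atTop_nhds_zero_nat.comp
        hφ.tendsto_atTop).const_mul 3)
    rw [mul_zero, add_zero] at h2
    refine le_of_tendsto (hlim x hx) ?_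
    filter_upwards [h2.eventually_lt_const hxy] with N hN
    exact (hupper (φ N) x hx).trans (hf.monotoneOn (mem_Ici.2 (by have := hδ (φ N); positivity))
      (mem_Ici.2 (by linarith)) hN.le)
  refine ⟨d, hd, hds, fun y hy => le_antisymm (hfd y hy) ?_⟩
  have hcont := (analyticOnNhd_tsum_mul_pow hds y (mem_univ y)).continuousAt
  refine le_of_tendsto (hcont.tendsto.mono_left (nhdsWithin_le_nhds (s := Iio y))) ?_
  filter_upwards [Ioo_mem_nhdsLT hy] with x hx
  exact hdf x y hx.1 hx.2

theorem exists_abs_sum_comp_le {ι : Type*} [Fintype ι] {F : ℝ → ℝ} (hF : ContDiff ℝ ∞ F)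
    (w b : ι → ℝ) (c : ℝ) {p : ℕ} (hw : ∀ l < p, ∑ k, w k * b k ^ l = 0) :
    ∃ C, ∀ u ∈ Icc (0 : ℝ) 1, |∑ k, w k * F (c + b k * u)| ≤ C * u ^ p := by
  obtain ⟨C, hC⟩ := exists_abs_sum_comp_sub_le hF w b c hw
  set A := iteratedDeriv p F c / p.factorial * ∑ k, w k * b k ^ p
  refine ⟨|A| + |C|, fun u hu => ?_⟩
  have hp : 0 ≤ u ^ p := pow_nonneg hu.1 p
  have h1 : |∑ k, w k * F (c + b k * u)| ≤ |A * u ^ p| + C * u ^ (p + 1) := by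
    have := abs_add_le (∑ k, w k * F (c + b k * u) - A * u ^ p) (A * u ^ p)
    rw [sub_add_cancel] at this
    linarith [hC u hu]
  have h2 : C * u ^ (p + 1) ≤ |C| * u ^ p := by
    rw [pow_succ]
    calc C * (u ^ p * u) ≤ |C| * (u ^ p * u) := by gcongr; exacts [mul_nonneg hp hu.1, le_abs_self C]
      _ ≤ |C| * (u ^ p * 1) := by gcongr; exact hu.2
      _ = _ := by ring
  rw [abs_mul, abs_of_nonneg hp] at h1
  linarith

/-- If `f` agrees with a smooth function `P` on the positive half-line, then `f - P` is flat
at the origin. -/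
theorem IsPlaneKernelPSD.exists_abs_sub_le_pow {f P : ℝ → ℝ} (hf : IsPlaneKernelPSD f)
    (hP : ContDiff ℝ ∞ P) (hfP : ∀ t, 0 < t → f t = P t) {τ : ℝ} (hτ : -2 < τ) (p : ℕ) :
    ∃ C, ∀ᶠ t in 𝓝[>] (0 : ℝ), |f (τ * t) - P (τ * t)| ≤ C * t ^ p := by
  let I := Fin (p + 1)
  let W : I × I → ℝ := fun k => diffCoeff p k.1 * diffCoeff p k.2
  have hdiag : ∀ β : ℝ, ∃ C, ∀ u ∈ Icc (0 : ℝ) 1,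
      |∑ k : I × I, W k * P (1 + (2 * (k.1 : ℕ) + β) * (2 * (k.2 : ℕ) + β) * u)| ≤ C * u ^ p :=
    fun β => exists_abs_sum_comp_le hP W
      (fun k => (2 * (k.1 : ℕ) + β) * (2 * (k.2 : ℕ) + β)) 1 fun l hl => by
        rw [sum_prod_mul_mul_pow _ (fun i : I => 2 * ((i : ℕ) : ℝ) + β)
          fun i => 2 * ((i : ℕ) : ℝ) + β, sum_diffCoeff_mul_affine_pow hl, zero_mul]
  obtain ⟨C₁, hC₁⟩ := hdiag 0
  obtain ⟨C₂, hC₂⟩ := hdiag τ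
  obtain ⟨C₃, hC₃⟩ := exists_abs_sum_comp_le hP W
    (fun k => 2 * (k.2 : ℕ) + (2 * (k.1 : ℕ) + τ)) 0 (p := p) fun l hl => by
      rw [Fintype.sum_prod_type]
      refine Finset.sum_eq_zero fun i _ => ?_
      simp only [W, mul_assoc]
      rw [← Finset.mul_sum, sum_diffCoeff_mul_affine_pow hl, mul_zero]
  have hpos : ∀ β : ℝ, ∀ᶠ t in 𝓝[>] (0 : ℝ), ∀ k : I × I,
      0 < 1 + (2 * (k.1 : ℕ) + β) * (2 * (k.2 : ℕ) + β) * t ^ 2 := fun β =>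
    eventually_all.2 fun k => by
      have hcont : Continuous fun t : ℝ =>
          1 + (2 * (k.1 : ℕ) + β) * (2 * (k.2 : ℕ) + β) * t ^ 2 := by fun_prop
      exact (hcont.tendsto 0).mono_left nhdsWithin_le_nhds |>.eventually_const_lt (by simp)
  refine ⟨(|C₁| + |C₂|) / 2 + C₃, ?_⟩
  filter_upwards [hpos 0, hpos τ, Ioo_mem_nhdsGT zero_lt_one] with t h1 h2 ht
  have ht2 : t ^ 2 ∈ Icc (0 : ℝ) 1 := ⟨by positivity, pow_le_one₀ ht.1.le ht.2.le⟩
  have htp : (t ^ 2) ^ p ≤ t ^ p := by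
    gcongr
    nlinarith [ht.1, ht.2]
  have hkernel := hf.abs_cross_sum_le (diffCoeff p) (fun _ => 1) (fun i => 2 * (i : ℕ) * t)
    (fun j => (2 * (j : ℕ) + τ) * t) fun _ => 1
  have e1 : ∑ i : I, ∑ j : I, diffCoeff p i * diffCoeff p j *
      f (1 * 1 + 2 * (i : ℕ) * t * (2 * (j : ℕ) * t)) =
      ∑ k : I × I, W k * P (1 + (2 * (k.1 : ℕ) + 0) * (2 * (k.2 : ℕ) + 0) * t ^ 2) := by
    rw [Fintype.sum_prod_type]
    refine Finset.sum_congr rfl fun i _ => Finset.sum_congr rfl fun j _ => ?_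
    rw [← hfP _ (h1 (i, j))]
    congr 2
    ring
  have e2 : ∑ i : I, ∑ j : I, diffCoeff p i * diffCoeff p j *
      f ((2 * (i : ℕ) + τ) * t * ((2 * (j : ℕ) + τ) * t) + 1 * 1) =
      ∑ k : I × I, W k * P (1 + (2 * (k.1 : ℕ) + τ) * (2 * (k.2 : ℕ) + τ) * t ^ 2) := by
    rw [Fintype.sum_prod_type]
    refine Finset.sum_congr rfl fun i _ => Finset.sum_congr rfl fun j _ => ?_
    rw [← hfP _ (h2 (i, j))]
    congr 2
    ring
  have e3 : ∑ i : I, ∑ j : I, diffCoeff p i * diffCoeff p j *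
      f (1 * ((2 * (j : ℕ) + τ) * t) + 2 * (i : ℕ) * t * 1) =
      (∑ k : I × I, W k * P (0 + (2 * (k.2 : ℕ) + (2 * (k.1 : ℕ) + τ)) * t)) +
        (f (τ * t) - P (τ * t)) := by
    rw [← sub_eq_iff_eq_add', ← Fintype.sum_prod_type'
      (f := fun i j : I => diffCoeff p i * diffCoeff p j *
        f (1 * ((2 * (j : ℕ) + τ) * t) + 2 * (i : ℕ) * t * 1)), ← Finset.sum_sub_distrib]
    have harg : ∀ i j : ℕ, 1 * ((2 * (j : ℝ) + τ) * t) + 2 * (i : ℝ) * t * 1 =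
        0 + (2 * (j : ℝ) + (2 * (i : ℝ) + τ)) * t := fun i j => by ring
    rw [Fintype.sum_eq_single (0, 0)]
    · have hsq : ((-1 : ℝ) ^ p) * (-1) ^ p = 1 := by rw [← mul_pow]; norm_num
      simp only [W, diffCoeff, Fin.val_zero, Nat.sub_zero, Nat.choose_zero_right, Nat.cast_one,
        mul_one, hsq, CharP.cast_eq_zero, mul_zero, zero_mul, zero_add, add_zero, one_mul]
    · rintro ⟨i, j⟩ hij
      have hsum : 1 ≤ (i : ℕ) + (j : ℕ) := by
        by_contra hlt
        exact hij (Prod.ext (Fin.ext (by simp only [Fin.val_zero]; omega))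
          (Fin.ext (by simp only [Fin.val_zero]; omega)))
      have hsum' : (1 : ℝ) ≤ (i : ℕ) + (j : ℕ) := by exact_mod_cast hsum
      simp only [W, harg]
      rw [hfP, sub_self]
      rw [zero_add]
      exact mul_pos (by linarith) ht.1
  rw [e1, e2, e3] at hkernel
  have b1 := (le_abs_self _).trans (hC₁ _ ht2)
  have b2 := (le_abs_self _).trans (hC₂ _ ht2)
  have b3 := hC₃ t ⟨ht.1.le, ht.2.le⟩
  have habs : ∀ C : ℝ, C * (t ^ 2) ^ p ≤ |C| * t ^ p := fun C =>
    (mul_le_mul_of_nonneg_right (le_abs_self C) (by positivity)).trans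
      (mul_le_mul_of_nonneg_left htp (abs_nonneg C))
  have b4 := abs_sub_le (f (τ * t) - P (τ * t))
    (-∑ k : I × I, W k * P (0 + (2 * (k.2 : ℕ) + (2 * (k.1 : ℕ) + τ)) * t)) 0
  rw [sub_neg_eq_add, sub_zero, sub_zero, abs_neg, add_comm (f (τ * t) - P (τ * t))] at b4
  linarith [habs C₁, habs C₂]

theorem AnalyticOnNhd.eq_zero_of_flat {G : ℝ → ℝ} (hG : AnalyticOnNhd ℝ G univ)
    (h : ∀ p : ℕ, ∃ C, ∀ᶠ t in 𝓝[>] (0 : ℝ), |G t| ≤ C * t ^ p) : G = 0 := by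
  refine hG.eq_of_eventuallyEq analyticOnNhd_const (z₀ := 0) ?_
  by_contra hne
  obtain ⟨n, q, hq, hq0, hGq⟩ :=
    (hG 0 (mem_univ 0)).exists_eventuallyEq_pow_smul_nonzero_iff.2 hne
  obtain ⟨C, hC⟩ := h (n + 1)
  refine hq0 (abs_nonpos_iff.1 ?_)
  have hlim : Tendsto (fun t : ℝ => C * t) (𝓝[>] 0) (𝓝 (C * 0)) :=
    ((continuous_const.mul continuous_id).tendsto 0).mono_left nhdsWithin_le_nhds
  rw [mul_zero] at hlim
  refine le_of_tendsto_of_tendsto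
    (hq.continuousAt.abs.tendsto.mono_left (nhdsWithin_le_nhds (s := Ioi 0))) hlim ?_
  filter_upwards [hC, nhdsWithin_le_nhds hGq, self_mem_nhdsWithin] with t h1 h2 ht
  have htn : 0 < t ^ n := pow_pos ht n
  rw [h2, sub_zero, smul_eq_mul, abs_mul, abs_of_pos htn, pow_succ] at h1
  refine le_of_mul_le_mul_left ?_ htn
  linarith

theorem stmt_7 (m : ℕ) (hm : 2 ≤ m) (f : ℝ → ℝ) (hf : FmR m f) :
    ∃ c : ℕ → ℝ, (∀ k, 0 ≤ c k) ∧
      ∀ t : ℝ, Filter.Tendsto (fun N => ∑ k ∈ Finset.range N, c k * t ^ k)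
        Filter.atTop (nhds (f t)) := by
  have hk := hf.isPlaneKernelPSD hm
  obtain ⟨e, he, hes, hfe⟩ :=
    (hk.add_mul_comp_neg (ε := 1) (by norm_num)).exists_eq_tsum_of_pos
  obtain ⟨o, ho, hos, hfo⟩ :=
    (hk.add_mul_comp_neg (ε := -1) (by norm_num)).exists_eq_tsum_of_pos
  let P : ℝ → ℝ := fun t => ((∑' k, e k * t ^ k) + ∑' k, o k * t ^ k) / 2
  let M : ℝ → ℝ := fun t => ((∑' k, e k * t ^ k) - ∑' k, o k * t ^ k) / 2
  have hE := analyticOnNhd_tsum_mul_pow hes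
  have hO := analyticOnNhd_tsum_mul_pow hos
  have hP : AnalyticOnNhd ℝ P univ := (hE.add hO).div analyticOnNhd_const fun _ _ => two_ne_zero
  have hM : AnalyticOnNhd ℝ M univ := (hE.sub hO).div analyticOnNhd_const fun _ _ => two_ne_zero
  have hfP : ∀ t, 0 < t → f t = P t := fun t ht => by
    simp only [P, ← hfe t ht, ← hfo t ht]
    ring
  have hfM : ∀ t, 0 < t → f (-t) = M t := fun t ht => by
    simp only [M, ← hfe t ht, ← hfo t ht]
    ring
  have hflat := fun {τ : ℝ} (hτ : -2 < τ) => hk.exists_abs_sub_le_pow hP.contDiff hfP hτ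
  have hzero : f 0 = P 0 := by
    obtain ⟨C, hC⟩ := hflat (τ := 0) (by norm_num) 1
    have hlim : Tendsto (fun t : ℝ => C * t ^ 1) (𝓝[>] 0) (𝓝 (C * 0 ^ 1)) :=
      ((continuous_const.mul (continuous_pow 1)).tendsto 0).mono_left nhdsWithin_le_nhds
    simp only [zero_mul] at hC
    have := ge_of_tendsto hlim hC
    rw [pow_one, mul_zero] at this
    exact sub_eq_zero.1 (abs_nonpos_iff.1 this)
  have hneg : (fun t => M t - P (-t)) = 0 := by
    have hPneg : AnalyticOnNhd ℝ (fun t => P (-t)) univ :=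
      hP.comp analyticOnNhd_id.neg (mapsTo_univ _ _)
    refine AnalyticOnNhd.eq_zero_of_flat (hM.sub hPneg) fun p => ?_
    obtain ⟨C, hC⟩ := hflat (τ := -1) (by norm_num) p
    refine ⟨C, ?_⟩
    filter_upwards [hC, self_mem_nhdsWithin] with t h1 ht
    rwa [neg_one_mul, hfM t ht] at h1
  refine ⟨fun k => (e k + o k) / 2, fun k => by have := he k; have := ho k; positivity, fun t => ?_⟩
  have hft : f t = P t := by
    rcases lt_trichotomy t 0 with ht | rfl | ht
    · have h1 := hfM (-t) (by linarith)
      have h2 := congrFun hneg (-t)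
      simp only [neg_neg, Pi.zero_apply] at h1 h2
      linarith
    · exact hzero
    · exact hfP t ht
  rw [hft]
  refine (((hes t).hasSum.add (hos t).hasSum).div_const 2).tendsto_sum_nat.congr fun N => ?_
  exact Finset.sum_congr rfl fun k _ => by ring
end

section
/- Fix m ∈ ℕ with m ≥ 3. If f ∈ F_m(ℂ), then the function z ↦ Re f(z) is continuous on ℂ. -/
open ComplexConjugate
open scoped ComplexOrder

/-- The real part of the kernel obtained by applying `f` to Gram matrices of vectors in `ℂ³`. -/
noncomputable def gramRe (f : ℂ → ℂ) (u v : Fin 3 → ℂ) : ℝ := (f (star u ⬝ᵥ v)).re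

theorem FmC.quadratic_nonneg {m : ℕ} (hm : 3 ≤ m) {f : ℂ → ℂ} (hf : FmC m f)
    (u v w : Fin 3 → ℂ) (x y z : ℝ) :
    0 ≤ x ^ 2 * gramRe f u u + y ^ 2 * gramRe f v v + z ^ 2 * gramRe f w w
      + 2 * x * y * gramRe f u v + 2 * x * z * gramRe f u w + 2 * y * z * gramRe f v w := by
  set V : Fin 3 → Fin 3 → ℂ := ![u, v, w]
  set B : Matrix (Fin 3) (Fin 3) ℂ := Matrix.of fun i j => V j i
  have hA := hf 3 (B.conjTranspose * B) (Matrix.posSemidef_conjTranspose_mul_self B)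
    (((Matrix.rank_le_card_width _).trans (by simp)).trans hm)
  have hent : ∀ i j, (B.conjTranspose * B) i j = star (V i) ⬝ᵥ V j := fun i j => rfl
  have hsymm : ∀ i j, gramRe f (V j) (V i) = gramRe f (V i) (V j) := fun i j => by
    have h := congrArg Complex.re (hA.1.apply i j)
    simpa [hent, gramRe] using h
  have h := (Complex.le_def.1 (hA.dotProduct_mulVec_nonneg ![(x : ℂ), y, z])).1
  have h10 := hsymm 0 1
  have h20 := hsymm 0 2
  have h21 := hsymm 1 2
  simp only [Matrix.mulVec, dotProduct, Fin.sum_univ_three, Matrix.map_apply, hent] at h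
  simp [gramRe, V, dotProduct, Fin.sum_univ_three] at h h10 h20 h21 ⊢
  rw [h10, h20, h21] at h
  linarith

theorem FmC.sq_gramRe_sub_le {m : ℕ} (hm : 3 ≤ m) {f : ℂ → ℂ} (hf : FmC m f)
    (u v w : Fin 3 → ℂ) :
    (gramRe f u w - gramRe f v w) ^ 2 ≤
      gramRe f w w * (gramRe f u u + gramRe f v v - 2 * gramRe f u v) := by
  have h := discrim_le_zero (a := gramRe f u u + gramRe f v v - 2 * gramRe f u v)
    (b := 2 * (gramRe f u w - gramRe f v w)) (c := gramRe f w w) fun s => by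
      linarith [hf.quadratic_nonneg hm u v w s (-s) 1]
  unfold discrim at h
  linarith

theorem FmC.sq_gramRe_le {m : ℕ} (hm : 3 ≤ m) {f : ℂ → ℂ} (hf : FmC m f) (u v : Fin 3 → ℂ) :
    gramRe f u v ^ 2 ≤ gramRe f u u * gramRe f v v := by
  have h := discrim_le_zero (a := gramRe f u u) (b := 2 * gramRe f u v) (c := gramRe f v v)
    fun s => by linarith [hf.quadratic_nonneg hm u v 0 s 1 0]
  unfold discrim at h
  linarith

theorem FmC.gramRe_self_nonneg {m : ℕ} (hm : 3 ≤ m) {f : ℂ → ℂ} (hf : FmC m f) (u : Fin 3 → ℂ) :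
    0 ≤ gramRe f u u := by
  linarith [hf.quadratic_nonneg hm u 0 0 1 0 0]

theorem FmC.re_ofReal_nonneg {m : ℕ} (hm : 3 ≤ m) {f : ℂ → ℂ} (hf : FmC m f) {a : ℝ}
    (ha : 0 ≤ a) : 0 ≤ (f a).re := by
  have h := hf.gramRe_self_nonneg hm ![((√a : ℝ) : ℂ), 0, 0]
  simpa [gramRe, dotProduct, Fin.sum_univ_three, ← Complex.ofReal_mul, Real.mul_self_sqrt ha]
    using h

theorem FmC.sq_re_mul_le {m : ℕ} (hm : 3 ≤ m) {f : ℂ → ℂ} (hf : FmC m f) (a b : ℝ) :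
    (f ((a * b : ℝ) : ℂ)).re ^ 2 ≤ (f ((a * a : ℝ) : ℂ)).re * (f ((b * b : ℝ) : ℂ)).re := by
  have h := hf.sq_gramRe_le hm ![(a : ℂ), 0, 0] ![(b : ℂ), 0, 0]
  simpa [gramRe, dotProduct, Fin.sum_univ_three] using h

theorem FmC.monotoneOn_re {m : ℕ} (hm : 3 ≤ m) {f : ℂ → ℂ} (hf : FmC m f) :
    MonotoneOn (fun a : ℝ => (f a).re) (Set.Ici 0) := by
  intro a ha b hb hab
  have h := hf.sq_gramRe_le hm ![((√a : ℝ) : ℂ), 0, 0] ![((√a : ℝ) : ℂ), ((√(b - a) : ℝ) : ℂ), 0]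
  simp [gramRe, dotProduct, Fin.sum_univ_three, ← Complex.ofReal_mul,
    Real.mul_self_sqrt (Set.mem_Ici.1 ha), Real.mul_self_sqrt (sub_nonneg.2 hab)] at h
  have ha' := hf.re_ofReal_nonneg hm ha
  have hb' := hf.re_ofReal_nonneg hm hb
  show (f a).re ≤ (f b).re
  by_contra! hlt
  nlinarith

open Filter Topology in
theorem FmC.tendsto_re_nhdsGT {m : ℕ} (hm : 3 ≤ m) {f : ℂ → ℂ} (hf : FmC m f) {t : ℝ}
    (ht : 0 < t) :
    Tendsto (fun a : ℝ => (f a).re) (𝓝[>] t) (𝓝 (f t).re) := by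
  set g : ℝ → ℝ := fun a => (f a).re
  have hmono : Monotone fun a => g (max a 0) := fun a b hab =>
    hf.monotoneOn_re hm (le_max_right a 0) (le_max_right b 0) (max_le_max_right 0 hab)
  obtain ⟨L, hL'⟩ : ∃ L, Tendsto (fun a => g (max a 0)) (𝓝[>] t) (𝓝 L) :=
    ⟨_, hmono.tendsto_nhdsGT t⟩
  have hL : Tendsto g (𝓝[>] t) (𝓝 L) := by
    refine hL'.congr' ?_
    filter_upwards [self_mem_nhdsWithin] with a ha
    rw [max_eq_left (ht.trans ha).le]
  have hgL : g t ≤ L := by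
    refine ge_of_tendsto hL ?_
    filter_upwards [self_mem_nhdsWithin] with a ha
    exact hf.monotoneOn_re hm ht.le (ht.trans ha).le (le_of_lt ha)
  have hmean : Tendsto (fun a : ℝ => √t * √a) (𝓝[>] t) (𝓝[>] t) := by
    refine tendsto_nhdsWithin_iff.2 ⟨?_, ?_⟩
    · have : Continuous fun a : ℝ => √t * √a := by fun_prop
      simpa [Real.mul_self_sqrt ht.le] using (this.tendsto t).mono_left nhdsWithin_le_nhds
    · filter_upwards [self_mem_nhdsWithin] with a ha
      calc t = √t * √t := (Real.mul_self_sqrt ht.le).symm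
        _ < √t * √a := by
          have := Real.sqrt_lt_sqrt ht.le ha
          have := Real.sqrt_pos.2 ht
          gcongr
  have hLsq : L ^ 2 ≤ g t * L := by
    refine le_of_tendsto_of_tendsto ((hL.comp hmean).pow 2) (hL.const_mul (g t)) ?_
    filter_upwards [self_mem_nhdsWithin] with a ha
    have h := hf.sq_re_mul_le hm (√t) (√a)
    rwa [Real.mul_self_sqrt ht.le, Real.mul_self_sqrt (ht.trans ha).le] at h
  have hg0 : 0 ≤ g t := hf.re_ofReal_nonneg hm ht.le
  have : L = g t := by
    refine le_antisymm ?_ hgL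
    by_contra! hlt
    nlinarith
  rwa [this] at hL

theorem FmC.sq_re_sub_le {m : ℕ} (hm : 3 ≤ m) {f : ℂ → ℂ} (hf : FmC m f) (z w : ℂ) :
    ((f z).re - (f w).re) ^ 2 ≤ (f 2).re *
      ((f ((‖w‖ ^ 2 + 1 + ‖z - w‖ ^ 2 : ℝ) : ℂ)).re - (f ((‖w‖ ^ 2 + 1 : ℝ) : ℂ)).re) := by
  have h := hf.sq_gramRe_sub_le hm ![conj w, conj (z - w), 1] ![conj w, 0, 1] ![1, 1, 0]
  have e1 : w + (z - w) = z := by ring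
  have e2 : w * conj w + (z - w) * conj (z - w) + 1
      = ((‖w‖ ^ 2 + 1 + ‖z - w‖ ^ 2 : ℝ) : ℂ) := by
    rw [Complex.mul_conj', Complex.mul_conj']
    push_cast
    ring
  have e3 : w * conj w + 1 = ((‖w‖ ^ 2 + 1 : ℝ) : ℂ) := by
    rw [Complex.mul_conj']
    push_cast
    ring
  have e4 : (1 : ℂ) + 1 = 2 := by norm_num
  simp only [gramRe, dotProduct, Fin.sum_univ_three, Pi.star_apply, Matrix.cons_val_zero,
    Matrix.cons_val_one, Matrix.cons_val, RCLike.star_def, Complex.conj_conj, map_zero, map_one,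
    mul_zero, add_zero, mul_one, e1, e2, e3, e4] at h
  linarith

open Filter Topology in
theorem stmt_8 (m : ℕ) (hm : 3 ≤ m) (f : ℂ → ℂ) (hf : FmC m f) :
    Continuous fun z : ℂ => (f z).re := by
  rw [continuous_iff_continuousAt]
  intro w
  set t : ℝ := ‖w‖ ^ 2 + 1
  have ht : 0 < t := by positivity
  have hright : Tendsto (fun a : ℝ => (f a).re) (𝓝[≥] t) (𝓝 (f t).re) :=
    continuousWithinAt_Ioi_iff_Ici.1 (hf.tendsto_re_nhdsGT hm ht)
  have harg : Tendsto (fun z : ℂ => t + ‖z - w‖ ^ 2) (𝓝 w) (𝓝[≥] t) := by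
    refine tendsto_nhdsWithin_iff.2 ⟨?_, Eventually.of_forall fun z => ?_⟩
    · have : Continuous fun z : ℂ => t + ‖z - w‖ ^ 2 := by fun_prop
      simpa using this.tendsto w
    · simp
  have hbound : Tendsto (fun z : ℂ => (f 2).re *
      ((f ((t + ‖z - w‖ ^ 2 : ℝ) : ℂ)).re - (f t).re)) (𝓝 w) (𝓝 0) := by
    simpa using ((hright.comp harg).sub_const (f t).re).const_mul (f 2).re
  have hsq : Tendsto (fun z : ℂ => ((f z).re - (f w).re) ^ 2) (𝓝 w) (𝓝 0) :=
    squeeze_zero (fun z => sq_nonneg _) (fun z => hf.sq_re_sub_le hm z w) hbound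
  have habs : Tendsto (fun z : ℂ => |(f z).re - (f w).re|) (𝓝 w) (𝓝 0) := by
    simpa [Real.sqrt_sq_eq_abs] using hsq.sqrt
  exact tendsto_iff_dist_tendsto_zero.2 habs
end

section
/- Let U : ℝ² → ℝ and suppose: (i) U is continuous; (ii) there exists a function (a, b, k) ↦ c_k(a,b) from ℝ² × ℝ² × ℕ to ℝ such that for all a, b ∈ ℝ² and every t ∈ ℝ the series Σ_{k=0}^∞ c_k(a,b) t^k converges with sum U(t·a + b); and (iii) for every M > 0 there exists a sequence of nonnegative reals (b_k(M))_{k∈ℕ} with |c_k(a,b)| ≤ b_k(M) for every k and all a, b ∈ ℝ² with ‖a‖ ≤ M and ‖b‖ ≤ M, and b_k(M)^{1/k} → 0 as k → ∞. Then there exists a function F : ℂ × ℂ → ℂ that is analytic on all of ℂ × ℂ (entire) such that F(x, y) = U(x, y) for every (x, y) ∈ ℝ². -/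
open Filter Topology Polynomial

/-- The root test for entire power series. -/
lemma summable_mul_pow_of_tendsto_root_zero {B : ℕ → ℝ} (hB : ∀ k, 0 ≤ B k)
    (h : Tendsto (fun k : ℕ => B k ^ ((k : ℝ)⁻¹)) atTop (𝓝 0)) {r : ℝ} (hr : 0 ≤ r) :
    Summable fun k => B k * r ^ k := by
  have h0 : Tendsto (fun k : ℕ => B k ^ ((k : ℝ)⁻¹) * r) atTop (𝓝 0) := by
    simpa using h.mul_const r
  have hev : ∀ᶠ k : ℕ in atTop, B k * r ^ k ≤ (1 / 2 : ℝ) ^ k := by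
    filter_upwards [h0.eventually (gt_mem_nhds (show (0 : ℝ) < 1 / 2 by norm_num)),
      eventually_ne_atTop 0] with k hk hk0
    have := pow_le_pow_left₀ (mul_nonneg (Real.rpow_nonneg (hB k) _) hr) hk.le k
    rwa [mul_pow, Real.rpow_inv_natCast_pow (hB k) hk0] at this
  refine Summable.of_norm_bounded_eventually_nat (summable_geometric_of_lt_one
    (by norm_num : (0 : ℝ) ≤ 1 / 2) (by norm_num)) ?_
  filter_upwards [hev] with k hk
  rwa [Real.norm_of_nonneg (mul_nonneg (hB k) (pow_nonneg hr k))]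

lemma hasSum_of_tendsto_sum_range {a b : ℕ → ℝ} {x : ℝ} (hab : ∀ k, |a k| ≤ b k)
    (hb : Summable b) (h : Tendsto (fun N => ∑ k ∈ Finset.range N, a k) atTop (𝓝 x)) :
    HasSum a x :=
  (Summable.of_norm_bounded hb hab).hasSum_iff_tendsto_nat.2 h

/-- A power series minus its partial sum of length `m` is `O(t ^ m)`. -/
lemma abs_sub_sum_range_le_of_hasSum {a b : ℕ → ℝ} {x t : ℝ} (hab : ∀ k, |a k| ≤ b k)
    (hb : Summable b) (ht : |t| ≤ 1) (h : HasSum (fun k => a k * t ^ k) x) (m : ℕ) :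
    |x - ∑ k ∈ Finset.range m, a k * t ^ k| ≤ |t| ^ m * ∑' k, b k := by
  have hb0 : ∀ k, 0 ≤ b k := fun k => (abs_nonneg _).trans (hab k)
  have hx : x - ∑ k ∈ Finset.range m, a k * t ^ k = ∑' k, a (k + m) * t ^ (k + m) := by
    rw [← h.tsum_eq, ← h.summable.sum_add_tsum_nat_add m]; ring
  have hbm : Summable fun k => b (k + m) := (summable_nat_add_iff m).2 hb
  have hle : ∑' k, b (k + m) ≤ ∑' k, b k := by
    rw [← hb.sum_add_tsum_nat_add m]
    exact le_add_of_nonneg_left (Finset.sum_nonneg fun k _ => hb0 k)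
  suffices hterm : ∀ k, ‖a (k + m) * t ^ (k + m)‖ ≤ |t| ^ m * b (k + m) by
    rw [hx]
    exact (tsum_of_norm_bounded (hbm.hasSum.mul_left (|t| ^ m)) hterm).trans
      (mul_le_mul_of_nonneg_left hle (by positivity))
  intro k
  rw [Real.norm_eq_abs, abs_mul, abs_pow, pow_add]
  have h1 : |t| ^ k ≤ 1 := pow_le_one₀ (abs_nonneg t) ht
  calc |a (k + m)| * (|t| ^ k * |t| ^ m) ≤ b (k + m) * (1 * |t| ^ m) := by
        gcongr
        · exact hb0 _
        · exact hab _
    _ = |t| ^ m * b (k + m) := by ring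

/-- The `k`-th coefficient of a power series as a limit at the origin. -/
lemma tendsto_coeff_of_hasSum {a : ℕ → ℝ} {f : ℝ → ℝ} (ha : Summable fun k => |a k|)
    (h : ∀ t, HasSum (fun k => a k * t ^ k) (f t)) (k : ℕ) :
    Tendsto (fun t => (t ^ k)⁻¹ * (f t - ∑ j ∈ Finset.range k, a j * t ^ j)) (𝓝[≠] 0)
      (𝓝 (a k)) := by
  rw [tendsto_iff_norm_sub_tendsto_zero]
  have hlim : Tendsto (fun t : ℝ => |t| * ∑' k, |a k|) (𝓝[≠] 0) (𝓝 0) := by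
    have : Tendsto (fun t : ℝ => |t| * ∑' k, |a k|) (𝓝 0) (𝓝 (|0| * ∑' k, |a k|)) :=
      (continuous_abs.mul continuous_const).tendsto 0
    simpa using this.mono_left nhdsWithin_le_nhds
  refine tendsto_of_tendsto_of_tendsto_of_le_of_le' tendsto_const_nhds hlim
    (Eventually.of_forall fun _ => norm_nonneg _) ?_
  filter_upwards [self_mem_nhdsWithin,
    nhdsWithin_le_nhds (Metric.closedBall_mem_nhds (0 : ℝ) one_pos)] with t ht ht1
  have ht0 : t ≠ 0 := ht
  have htk : 0 < |t| ^ k := pow_pos (abs_pos.2 ht0) k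
  have hb := abs_sub_sum_range_le_of_hasSum (fun k => le_refl |a k|) ha
    (by simpa using ht1) (h t) (k + 1)
  have he : (t ^ k)⁻¹ * (f t - ∑ j ∈ Finset.range k, a j * t ^ j) - a k
      = (t ^ k)⁻¹ * (f t - ∑ j ∈ Finset.range (k + 1), a j * t ^ j) := by
    rw [Finset.sum_range_succ]; field_simp; ring
  rw [he, Real.norm_eq_abs, abs_mul, abs_inv, abs_pow, inv_mul_le_iff₀ htk]
  exact hb.trans_eq (by ring)

lemma coeff_eq_of_hasSum {a b : ℕ → ℝ} {f : ℝ → ℝ} (ha : ∀ t, HasSum (fun k => a k * t ^ k) (f t))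
    (hb : ∀ t, HasSum (fun k => b k * t ^ k) (f t)) (k : ℕ) : a k = b k := by
  have ha1 : Summable fun k => |a k| := by simpa using (ha 1).summable.abs
  have hb1 : Summable fun k => |b k| := by simpa using (hb 1).summable.abs
  induction k using Nat.strong_induction_on with
  | _ k ih =>
    refine tendsto_nhds_unique (tendsto_coeff_of_hasSum ha1 ha k) ?_
    have hs : ∀ t : ℝ, ∑ j ∈ Finset.range k, a j * t ^ j = ∑ j ∈ Finset.range k, b j * t ^ j :=
      fun t => Finset.sum_congr rfl fun j hj => by rw [ih j (Finset.mem_range.1 hj)]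
    simpa only [hs] using tendsto_coeff_of_hasSum hb1 hb k

/-- The space of real polynomial functions of degree less than `n`. -/
noncomputable def polynomialFunctionsLT (n : ℕ) : Submodule ℝ (ℝ → ℝ) :=
  (degreeLT ℝ n).map (LinearMap.pi fun s : ℝ => leval s)

lemma mem_polynomialFunctionsLT {n : ℕ} {f : ℝ → ℝ} :
    f ∈ polynomialFunctionsLT n ↔ ∃ p : ℝ[X], p.degree < n ∧ ∀ s, f s = p.eval s := by
  simp only [polynomialFunctionsLT, Submodule.mem_map, mem_degreeLT]
  refine exists_congr fun p => and_congr_right fun _ => ?_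
  rw [funext_iff]
  exact forall_congr' fun s => eq_comm

lemma polynomialFunctionsLT_mono {m n : ℕ} (h : m ≤ n) :
    polynomialFunctionsLT m ≤ polynomialFunctionsLT n :=
  Submodule.map_mono (degreeLT_mono h)

lemma pow_mem_polynomialFunctionsLT {m n : ℕ} (h : m < n) :
    (fun s : ℝ => s ^ m) ∈ polynomialFunctionsLT n :=
  mem_polynomialFunctionsLT.2 ⟨X ^ m, by rw [degree_X_pow]; exact_mod_cast h, by simp⟩

lemma isClosed_polynomialFunctionsLT (n : ℕ) :
    IsClosed (polynomialFunctionsLT n : Set (ℝ → ℝ)) := by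
  have : FiniteDimensional ℝ (polynomialFunctionsLT n) := by
    unfold polynomialFunctionsLT; infer_instance
  exact Submodule.closed_of_finiteDimensional _

/-- If `f (t, t s)` expands in powers of `t` for each `s`, and in powers of `t s` with uniformly
dominated coefficients, then the coefficient of `t ^ k` is polynomial in `s` of degree at most
`k`. -/
lemma coeff_mem_polynomialFunctionsLT {q : ℕ → ℝ → ℝ} {d : ℝ → ℕ → ℝ} {f : ℝ → ℝ → ℝ} {B : ℕ → ℝ}
    (hq : ∀ s t, HasSum (fun k => q k s * t ^ k) (f s t))
    (hd : ∀ s t, HasSum (fun k => d t k * (t * s) ^ k) (f s t))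
    (hdB : ∀ t, |t| ≤ 1 → ∀ k, |d t k| ≤ B k)
    (hB : ∀ r : ℝ, 0 ≤ r → Summable fun k => B k * r ^ k) (k : ℕ) :
    q k ∈ polynomialFunctionsLT (k + 1) := by
  induction k using Nat.strong_induction_on with
  | _ k ih =>
    let g : ℝ → ℝ → ℝ := fun t s => (t ^ k)⁻¹ *
      (∑ n ∈ Finset.range (k + 1), d t n * (t * s) ^ n - ∑ j ∈ Finset.range k, q j s * t ^ j)
    have hg : ∀ t, g t ∈ polynomialFunctionsLT (k + 1) := by
      intro t
      have : g t = (t ^ k)⁻¹ • (∑ n ∈ Finset.range (k + 1), (d t n * t ^ n) • (fun s : ℝ => s ^ n)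
          - ∑ j ∈ Finset.range k, t ^ j • q j) := by
        ext s
        simp only [g, Pi.smul_apply, Pi.sub_apply, Finset.sum_apply, smul_eq_mul, mul_pow]
        congr 2
        · exact Finset.sum_congr rfl fun n _ => by ring
        · exact Finset.sum_congr rfl fun n _ => by ring
      rw [this]
      refine Submodule.smul_mem _ _ (Submodule.sub_mem _ (Submodule.sum_mem _ fun n hn =>
        Submodule.smul_mem _ _ (pow_mem_polynomialFunctionsLT (Finset.mem_range.1 hn)))
        (Submodule.sum_mem _ fun j hj => Submodule.smul_mem _ _ ?_))
      have hjk := Finset.mem_range.1 hj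
      exact polynomialFunctionsLT_mono (by omega) (ih j hjk)
    refine (isClosed_polynomialFunctionsLT (k + 1)).mem_of_tendsto (f := g) (b := 𝓝[≠] (0 : ℝ)) ?_
      (Eventually.of_forall hg)
    rw [tendsto_pi_nhds]
    intro s
    have h1 := tendsto_coeff_of_hasSum (by simpa using (hq s 1).summable.abs) (hq s) k
    have h2 : Tendsto (fun t : ℝ => (t ^ k)⁻¹ * (f s t -
        ∑ n ∈ Finset.range (k + 1), d t n * (t * s) ^ n)) (𝓝[≠] 0) (𝓝 0) := by
      rw [tendsto_zero_iff_norm_tendsto_zero]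
      have hlim : Tendsto (fun t : ℝ => |t| * ∑' k, B k * |s| ^ k) (𝓝[≠] 0) (𝓝 0) := by
        have : Tendsto (fun t : ℝ => |t| * ∑' k, B k * |s| ^ k) (𝓝 0)
            (𝓝 (|0| * ∑' k, B k * |s| ^ k)) := (continuous_abs.mul continuous_const).tendsto 0
        simpa using this.mono_left nhdsWithin_le_nhds
      refine tendsto_of_tendsto_of_tendsto_of_le_of_le' tendsto_const_nhds hlim
        (Eventually.of_forall fun _ => norm_nonneg _) ?_
      filter_upwards [self_mem_nhdsWithin,
        nhdsWithin_le_nhds (Metric.closedBall_mem_nhds (0 : ℝ) one_pos)] with t ht ht1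
      have htk : 0 < |t| ^ k := pow_pos (abs_pos.2 ht) k
      have ht1 : |t| ≤ 1 := by simpa using ht1
      have hds : ∀ n, |d t n * s ^ n| ≤ B n * |s| ^ n := fun n => by
        rw [abs_mul, abs_pow]
        exact mul_le_mul_of_nonneg_right (hdB t ht1 n) (by positivity)
      have hb := abs_sub_sum_range_le_of_hasSum (x := f s t) hds (hB |s| (abs_nonneg s)) ht1
        (by convert hd s t using 2 with n; ring) (k + 1)
      have he : ∑ n ∈ Finset.range (k + 1), d t n * s ^ n * t ^ n =
          ∑ n ∈ Finset.range (k + 1), d t n * (t * s) ^ n :=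
        Finset.sum_congr rfl fun n _ => by ring
      rw [he] at hb
      rw [Real.norm_eq_abs, abs_mul, abs_inv, abs_pow, inv_mul_le_iff₀ htk]
      exact hb.trans_eq (by ring)
    convert h1.sub h2 using 2 with t
    · simp only [g]; ring
    · simp

/-- Cauchy's estimate for the coefficients of a polynomial. -/
lemma norm_coeff_le_of_forall_norm_eq_one {p : ℂ[X]} {C : ℝ}
    (h : ∀ z : ℂ, ‖z‖ = 1 → ‖p.eval z‖ ≤ C) (n : ℕ) : ‖p.coeff n‖ ≤ C := by
  have hit : ∀ n, iteratedDeriv n (fun z => p.eval z) = fun z => (derivative^[n] p).eval z := by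
    intro n
    induction n with
    | zero => simp
    | succ n ih =>
      rw [iteratedDeriv_succ, ih, Function.iterate_succ_apply']
      ext z
      rw [Polynomial.deriv]
  have := Complex.norm_iteratedDeriv_le_of_forall_mem_sphere_norm_le (c := 0) n one_pos
    p.differentiable.diffContOnCl (C := C) (fun z hz => h z (by simpa using hz))
  rw [hit] at this
  simp only [← coeff_zero_eq_eval_zero, coeff_iterate_derivative, zero_add, Nat.descFactorial_self,
    nsmul_eq_mul, norm_mul, one_pow, div_one, Complex.norm_natCast] at this
  exact le_of_mul_le_mul_left this (by positivity)

/-- As above, with one point of the circle left out. -/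
lemma norm_coeff_le_of_forall_norm_eq_one_of_ne_one {p : ℂ[X]} {C : ℝ}
    (h : ∀ z : ℂ, ‖z‖ = 1 → z ≠ 1 → ‖p.eval z‖ ≤ C) (n : ℕ) : ‖p.coeff n‖ ≤ C := by
  refine norm_coeff_le_of_forall_norm_eq_one (fun z hz => ?_) n
  by_cases hz1 : z = 1
  · subst hz1
    have hu : Tendsto (fun n : ℕ => Complex.exp ((1 / ((n : ℝ) + 1) : ℝ) * Complex.I)) atTop
        (𝓝 1) := by
      have h0 : Continuous fun x : ℝ => Complex.exp (x * Complex.I) := by fun_prop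
      have h1 := (h0.tendsto 0).comp (tendsto_one_div_add_atTop_nhds_zero_nat (𝕜 := ℝ))
      rwa [Complex.ofReal_zero, zero_mul, Complex.exp_zero] at h1
    refine le_of_tendsto ((p.continuous.norm.tendsto 1).comp hu) (Eventually.of_forall fun n => ?_)
    refine h _ (Complex.norm_exp_ofReal_mul_I _) fun he => ?_
    have hs := congrArg Complex.im he
    rw [Complex.exp_ofReal_mul_I_im, Complex.one_im] at hs
    have hn : (0 : ℝ) < 1 / ((n : ℝ) + 1) := by positivity
    have hn1 : 1 / ((n : ℝ) + 1) ≤ 1 := by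
      rw [div_le_one (by positivity)]; linarith [(Nat.cast_nonneg n : (0 : ℝ) ≤ n)]
    exact (Real.sin_pos_of_pos_of_le_one hn hn1).ne' hs
  · exact h z hz hz1

/-- A real binary form `y ^ k q(x / y)` rewritten in the variables `u = x + iy`, `x - iy`; its
coefficients are bounded by the sup of the form on the unit circle. -/
lemma exists_coeff_conj_form {q : ℝ → ℝ} {k : ℕ} {K : ℝ} (hq : q ∈ polynomialFunctionsLT (k + 1))
    (hK : ∀ x y : ℝ, y ≠ 0 → x ^ 2 + y ^ 2 = 1 → |y ^ k * q (x / y)| ≤ K) :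
    ∃ β : ℕ → ℂ, (∀ j, ‖β j‖ ≤ K) ∧ ∀ x y : ℝ, y ≠ 0 →
      ((y ^ k * q (x / y) : ℝ) : ℂ) = ∑ j ∈ Finset.range (k + 1),
        β j * ((x + Complex.I * y) ^ j * (x - Complex.I * y) ^ (k - j)) := by
  obtain ⟨r, hr, hqr⟩ := mem_polynomialFunctionsLT.1 hq
  have hr' : r.natDegree < k + 1 := by
    by_cases h0 : r = 0
    · simp [h0]
    · exact (natDegree_lt_iff_degree_lt h0).2 hr
  let p : ℂ[X] := ∑ i ∈ Finset.range (k + 1), C (r.coeff i : ℂ) *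
    ((C (1 / 2) * (X + 1)) ^ i * (C (-Complex.I / 2) * (X - 1)) ^ (k - i))
  have hp : p.natDegree < k + 1 := by
    refine Nat.lt_succ_of_le (natDegree_sum_le_of_forall_le _ _ fun i hi => ?_)
    have hi := Finset.mem_range.1 hi
    have h1 : (C (1 / 2 : ℂ) * (X + 1)).natDegree ≤ 1 := by compute_degree
    have h2 : (C (-Complex.I / 2) * (X - 1)).natDegree ≤ 1 := by compute_degree
    refine (natDegree_C_mul_le _ _).trans (natDegree_mul_le.trans ?_)
    have h3 := natDegree_pow_le_of_le i h1
    have h4 := natDegree_pow_le_of_le (k - i) h2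
    omega
  have key : ∀ x y : ℝ, y ≠ 0 → ((y ^ k * q (x / y) : ℝ) : ℂ) =
      (x - Complex.I * y) ^ k * p.eval ((x + Complex.I * y) / (x - Complex.I * y)) := by
    intro x y hy
    have hv : (x - Complex.I * y : ℂ) ≠ 0 := by
      intro h
      have := congrArg Complex.im h
      simp at this
      exact hy this
    have hyc : (y : ℂ) ≠ 0 := by exact_mod_cast hy
    rw [hqr, eval_eq_sum_range' hr', eval_finsetSum, Finset.mul_sum, Finset.mul_sum]
    push_cast
    refine Finset.sum_congr rfl fun i hi => ?_
    have hi := Finset.mem_range.1 hi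
    obtain ⟨l, rfl⟩ : ∃ l, k = i + l := ⟨k - i, by omega⟩
    simp only [eval_mul, eval_C, eval_pow, eval_add, eval_sub, eval_X, eval_one,
      Nat.add_sub_cancel_left]
    have hw : (x - Complex.I * y : ℂ) * ((x + Complex.I * y) / (x - Complex.I * y)) =
        x + Complex.I * y := mul_div_cancel₀ _ hv
    generalize (x + Complex.I * y : ℂ) / (x - Complex.I * y) = w at hw ⊢
    have h1 : (x : ℂ) ^ i = (x - Complex.I * y) ^ i * (1 / 2 * (w + 1)) ^ i := by
      rw [← mul_pow]; congr 1
      linear_combination (-1 / 2) * hw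
    have h2 : (y : ℂ) ^ l = (x - Complex.I * y) ^ l * (-Complex.I / 2 * (w - 1)) ^ l := by
      rw [← mul_pow]; congr 1
      linear_combination (Complex.I / 2) * hw + y * Complex.I_sq
    calc (y : ℂ) ^ (i + l) * (r.coeff i * (x / y) ^ i) = r.coeff i * ((x : ℂ) ^ i * y ^ l) := by
          rw [div_pow, pow_add]; field_simp
      _ = _ := by rw [h1, h2, pow_add]; ring
  refine ⟨p.coeff, norm_coeff_le_of_forall_norm_eq_one_of_ne_one fun z hz hz1 => ?_,
    fun x y hy => ?_⟩
  · obtain ⟨u, hu⟩ := IsAlgClosed.exists_pow_nat_eq z two_pos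
    have hu1 : ‖u‖ = 1 := by
      have : ‖u‖ ^ 2 = 1 := by rw [← norm_pow, hu, hz]
      exact (pow_eq_one_iff_of_nonneg (norm_nonneg u) two_ne_zero).1 this
    have hun : u.re ^ 2 + u.im ^ 2 = 1 := by
      have := Complex.sq_norm u
      rw [hu1, Complex.normSq_apply] at this
      linarith
    have him : u.im ≠ 0 := by
      intro h
      apply hz1
      rw [← hu]
      apply Complex.ext
      · simp [pow_two, h] at hun ⊢; exact hun
      · simp [pow_two, h]
    have hre : (u.re + Complex.I * u.im : ℂ) = u := by rw [mul_comm]; exact Complex.re_add_im u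
    have hcj : (u.re - Complex.I * u.im : ℂ) = starRingEnd ℂ u := by
      apply Complex.ext <;> simp
    have hk := key u.re u.im him
    rw [hre, hcj] at hk
    have hcz : u / starRingEnd ℂ u = z := by
      have h0 : starRingEnd ℂ u * u = 1 := by
        rw [Complex.conj_mul', hu1]; norm_num
      have h1 : starRingEnd ℂ u ≠ 0 := left_ne_zero_of_mul_eq_one h0
      rw [div_eq_iff h1, ← hu, pow_two, mul_assoc, mul_comm u (starRingEnd ℂ u), h0, mul_one]
    rw [hcz] at hk
    have := hK u.re u.im him hun
    rwa [← Real.norm_eq_abs, ← Complex.norm_real, hk, norm_mul, norm_pow, RCLike.norm_conj, hu1,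
      one_pow, one_mul] at this
  · rw [key x y hy, eval_eq_sum_range' hp, Finset.mul_sum]
    have hv : (x - Complex.I * y : ℂ) ≠ 0 := by
      intro h
      have := congrArg Complex.im h
      simp at this
      exact hy this
    refine Finset.sum_congr rfl fun j hj => ?_
    have hj := Finset.mem_range.1 hj
    obtain ⟨l, rfl⟩ : ∃ l, k = j + l := ⟨k - j, by omega⟩
    rw [Nat.add_sub_cancel_left, div_pow, pow_add]
    field_simp

/-- A double power series in two linear forms defines an entire function. -/
lemma exists_entire_of_summable {E : Type*} [NormedAddCommGroup E] [NormedSpace ℂ E]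
    (L₁ L₂ : E →L[ℂ] ℂ) {β : ℕ → ℕ → ℂ} {B : ℕ → ℝ} (hβ : ∀ k j, ‖β k j‖ ≤ B k)
    (hB : ∀ r : ℝ, 0 ≤ r → Summable fun k => B k * r ^ k) :
    ∃ F : E → ℂ, (∀ z, AnalyticAt ℂ F z) ∧ ∀ z, HasSum (fun k =>
      ∑ j ∈ Finset.range (k + 1), β k j * (L₁ z ^ j * L₂ z ^ (k - j))) (F z) := by
  let p : FormalMultilinearSeries ℂ E ℂ := fun k => ∑ j ∈ Finset.range (k + 1), β k j •
    (ContinuousMultilinearMap.mkPiAlgebra ℂ (Fin k) ℂ).compContinuousLinearMap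
      fun i => if (i : ℕ) < j then L₁ else L₂
  have hB0 : ∀ k, 0 ≤ B k := fun k => (norm_nonneg _).trans (hβ k 0)
  let R : ℝ := max ‖L₁‖ ‖L₂‖
  have hR : 0 ≤ R := le_max_of_le_left (norm_nonneg _)
  have hpn : ∀ k, ‖p k‖ ≤ B k * (2 * R) ^ k := by
    intro k
    have hk : ((k : ℝ) + 1) ≤ 2 ^ k := by exact_mod_cast Nat.lt_two_pow_self (n := k)
    have : ‖p k‖ ≤ ∑ j ∈ Finset.range (k + 1), B k * R ^ k := by
      refine norm_sum_le_of_le _ fun j _ => ?_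
      rw [norm_smul]
      refine mul_le_mul (hβ k j) ?_ (norm_nonneg _) (hB0 k)
      refine (ContinuousMultilinearMap.norm_compContinuousLinearMap_le _ _).trans ?_
      rw [ContinuousMultilinearMap.norm_mkPiAlgebra, one_mul]
      refine (Finset.prod_le_prod (fun i _ => norm_nonneg _) (g := fun _ => R) fun i _ => ?_).trans_eq
        (by simp)
      split_ifs
      · exact le_max_left _ _
      · exact le_max_right _ _
    refine this.trans ?_
    rw [Finset.sum_const, Finset.card_range, nsmul_eq_mul, mul_pow]
    push_cast
    calc ((k : ℝ) + 1) * (B k * R ^ k) ≤ 2 ^ k * (B k * R ^ k) := by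
          have := mul_nonneg (hB0 k) (pow_nonneg hR k)
          gcongr
      _ = _ := by ring
  have hrad : p.radius = ⊤ := by
    refine p.radius_eq_top_of_summable_norm fun r => ?_
    refine Summable.of_nonneg_of_le (fun k => by positivity) (fun k => ?_)
      (hB (2 * R * r) (by positivity))
    rw [mul_pow (2 * R), ← mul_assoc]
    exact mul_le_mul_of_nonneg_right (hpn k) (by positivity)
  have hps := p.hasFPowerSeriesOnBall (by rw [hrad]; exact ENNReal.zero_lt_top)
  rw [hrad] at hps
  refine ⟨p.sum, fun z => hps.analyticAt_of_mem (by simp), fun z => ?_⟩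
  have hs := hps.hasSum (y := z) (by simp)
  rw [zero_add] at hs
  suffices hk : ∀ k, ∑ j ∈ Finset.range (k + 1), β k j * (L₁ z ^ j * L₂ z ^ (k - j)) =
      p k fun _ => z by simpa only [hk] using hs
  intro k
  simp only [p, sum_apply, smul_apply,
    ContinuousMultilinearMap.compContinuousLinearMap_apply,
    ContinuousMultilinearMap.mkPiAlgebra_apply, smul_eq_mul]
  refine Finset.sum_congr rfl fun j hj => ?_
  have hj := Finset.mem_range.1 hj
  obtain ⟨l, rfl⟩ : ∃ l, k = j + l := ⟨k - j, by omega⟩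
  congr 1
  rw [Fin.prod_univ_add]
  simp

/-- `ℝ²` with the Euclidean norm. -/
theorem stmt_10 (U : EuclideanSpace ℝ (Fin 2) → ℝ) (hU : Continuous U)
    (c : EuclideanSpace ℝ (Fin 2) → EuclideanSpace ℝ (Fin 2) → ℕ → ℝ)
    (hc : ∀ (a b : EuclideanSpace ℝ (Fin 2)) (t : ℝ),
      Filter.Tendsto (fun N => ∑ k ∈ Finset.range N, c a b k * t ^ k) Filter.atTop
        (nhds (U (t • a + b))))
    (hbd : ∀ M : ℝ, 0 < M → ∃ B : ℕ → ℝ, (∀ k, 0 ≤ B k) ∧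
      (∀ (k : ℕ) (a b : EuclideanSpace ℝ (Fin 2)), ‖a‖ ≤ M → ‖b‖ ≤ M → |c a b k| ≤ B k) ∧
      Filter.Tendsto (fun k : ℕ => B k ^ ((k : ℝ)⁻¹)) Filter.atTop (nhds 0)) :
    ∃ F : ℂ × ℂ → ℂ, (∀ p : ℂ × ℂ, AnalyticAt ℂ F p) ∧
      ∀ x : EuclideanSpace ℝ (Fin 2), F ((x 0 : ℂ), (x 1 : ℂ)) = ((U x : ℝ) : ℂ) := by
  have hsum : ∀ a b t, HasSum (fun k => c a b k * t ^ k) (U (t • a + b)) := by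
    intro a b t
    obtain ⟨B, hB0, hB, hBt⟩ := hbd (max ‖a‖ ‖b‖ + 1) (by positivity)
    refine hasSum_of_tendsto_sum_range (fun k => ?_)
      (summable_mul_pow_of_tendsto_root_zero hB0 hBt (abs_nonneg t)) (hc a b t)
    rw [abs_mul, abs_pow]
    exact mul_le_mul_of_nonneg_right (hB k a b ((le_max_left _ _).trans (le_add_of_nonneg_right zero_le_one))
      ((le_max_right _ _).trans (le_add_of_nonneg_right zero_le_one))) (by positivity)
  obtain ⟨B, hB0, hB, hBt⟩ := hbd 1 one_pos
  have hBs : ∀ r : ℝ, 0 ≤ r → Summable fun k => B k * r ^ k := fun r hr =>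
    summable_mul_pow_of_tendsto_root_zero hB0 hBt hr
  let q : ℕ → ℝ → ℝ := fun k s => c !₂[s, 1] 0 k
  have hq : ∀ k, q k ∈ polynomialFunctionsLT (k + 1) := by
    refine coeff_mem_polynomialFunctionsLT (d := fun t k => c !₂[1, 0] !₂[0, t] k)
      (f := fun s t => U !₂[t * s, t]) (B := B) (fun s t => ?_) (fun s t => ?_)
      (fun t ht k => ?_) hBs
    · convert hsum !₂[s, 1] 0 t using 2
      ext i; fin_cases i <;> simp
    · convert hsum !₂[1, 0] !₂[0, t] (t * s) using 2
      ext i; fin_cases i <;> simp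
    · refine hB k _ _ ?_ ?_
      · simp [EuclideanSpace.norm_eq]
      · simpa [EuclideanSpace.norm_eq, Real.sqrt_sq_eq_abs] using ht
  have hhom : ∀ (k : ℕ) (x y : ℝ), y ≠ 0 → c !₂[x, y] 0 k = y ^ k * q k (x / y) := by
    intro k x y hy
    refine coeff_eq_of_hasSum (a := c !₂[x, y] 0) (b := fun k => y ^ k * q k (x / y))
      (f := fun t => U (t • !₂[x, y] + 0)) (hsum _ _) (fun t => ?_) k
    convert hsum !₂[x / y, 1] 0 (t * y) using 2
    · simp only [q]; ring
    · ext i; fin_cases i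
      · simp; field_simp
      · simp
  have hβ : ∀ k, ∃ β : ℕ → ℂ, (∀ j, ‖β j‖ ≤ B k) ∧ ∀ x y : ℝ, y ≠ 0 →
      ((y ^ k * q k (x / y) : ℝ) : ℂ) = ∑ j ∈ Finset.range (k + 1),
        β j * ((x + Complex.I * y) ^ j * (x - Complex.I * y) ^ (k - j)) := fun k =>
    exists_coeff_conj_form (hq k) fun x y hy hxy => by
      rw [← hhom k x y hy]
      refine hB k _ _ ?_ (by simp)
      simp [EuclideanSpace.norm_eq, hxy]
  choose β hβB hβq using hβ
  obtain ⟨F, hF, hFs⟩ := exists_entire_of_summable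
    (ContinuousLinearMap.fst ℂ ℂ ℂ + Complex.I • ContinuousLinearMap.snd ℂ ℂ ℂ)
    (ContinuousLinearMap.fst ℂ ℂ ℂ - Complex.I • ContinuousLinearMap.snd ℂ ℂ ℂ) hβB hBs
  refine ⟨F, hF, ?_⟩
  have hFc : Continuous F := continuous_iff_continuousAt.2 fun z => (hF z).continuousAt
  have hoff : ∀ x y : ℝ, y ≠ 0 → F (x, y) = U !₂[x, y] := by
    intro x y hy
    have h1 := hsum !₂[x, y] 0 1
    simp only [one_pow, mul_one, one_smul, add_zero, hhom _ x y hy] at h1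
    have h2 := Complex.hasSum_ofReal.2 h1
    refine (hFs (x, y)).unique ?_
    convert h2 using 2 with k
    rw [hβq k x y hy]
    simp
  intro z
  have hpath : Continuous fun y : ℝ => F ((z 0 : ℂ), (y : ℂ)) := by fun_prop
  have hpath' : Continuous fun y : ℝ => ((U !₂[z 0, y] : ℝ) : ℂ) := by fun_prop
  have := congrFun (hpath.ext_on (dense_compl_singleton (0 : ℝ)) hpath'
    fun y hy => hoff (z 0) y hy) (z 1)
  simp only at this
  rw [this]
  congr 2
  ext i; fin_cases i <;> simp
end
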